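/- arXiv:1205.1331 — 8 statements merged into one kernel-verified Lean document; each statement's English description precedes it below -/
import Mathlib

section
/- There exist constants c₁ ∈ (0,1] and C ≥ 0 depending only on α with the following property: for every finite admissible set of links L there is a subset L' ⊆ L with |L'| ≥ c₁·|L| such that for every link ℓ ∈ R (not only ℓ ∈ L), Σ_{ℓ'∈L'} w(ℓ,ℓ') ≤ C. -/
open Finset

universe u v

noncomputable def sinr {X : Type u} {ι : Type v} [MetricSpace X] [DecidableEq ι]
    (α N : ℝ) (s r : ι → X) (p : ι → ℝ) (L : Finset ι) (i : ι) : ℝ :=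
  (p i / dist (s i) (r i) ^ α) /
    ((∑ j ∈ L.erase i, p j / dist (s j) (r i) ^ α) + N)

/-- A set `L` of links is admissible if some nonnegative power assignment gives
every link of `L` an SINR at least its threshold `β`. -/
def Admissible {X : Type u} {ι : Type v} [MetricSpace X] [DecidableEq ι]
    (α N : ℝ) (s r : ι → X) (β : ι → ℝ) (L : Finset ι) : Prop :=
  ∃ p : ι → ℝ, (∀ i ∈ L, 0 ≤ p i) ∧ ∀ i ∈ L, β i ≤ sinr α N s r p L i

/-- The weight `w(ℓ_i, ℓ_j)` between two links, where `π` gives the processing order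
(by nonincreasing sensitivity `β(ℓ)·d(ℓ)^α`); it is nonzero exactly when `π i > π j`. -/
noncomputable def weight {X : Type u} {ι : Type v} [MetricSpace X]
    (α : ℝ) (s r : ι → X) (β : ι → ℝ) (π : ι → ℕ) (i j : ι) : ℝ :=
  if π j < π i then
    min 1 (β i * β j * (dist (s i) (r i) ^ α * dist (s j) (r j) ^ α) /
        (dist (s i) (r j) ^ α * dist (s j) (r i) ^ α)
      + β i * dist (s i) (r i) ^ α / dist (s i) (r j) ^ α
      + β i * dist (s i) (r i) ^ α / dist (s j) (r i) ^ α)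
  else 0

lemma aux_base (u v uk R Rj Rk dkj djk di dj dk : ℝ) (hu : 0 < u) (hv : 0 < v)
    (huv : u ≤ v) (huk : uk ≤ u) (hR : 0 < R) (hRj : R ≤ Rj) (hRk : R ≤ Rk)
    (hdi : di ≤ R) (hdj : dj ≤ Rj) (hdk : dk ≤ Rk) (hkj0 : 0 < dkj) (hjk0 : 0 < djk)
    (hkj : dkj ≤ dk + uk + u) (hjk : djk ≤ dj + u + uk) (hj : dj ≤ v + di + u) :
    min 1 (R * Rj / (u * v)) ≤ 16 * (Rk * Rj / (dkj * djk)) := by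
  have hRj0 : 0 < Rj := by linarith
  have hRk0 : 0 < Rk := by linarith
  rw [← mul_div_assoc, le_div_iff₀ (mul_pos hkj0 hjk0)]
  rcases le_or_gt u Rk with h1 | h1
  · have a1 : dkj ≤ 3 * Rk := by linarith
    rcases le_or_gt u Rj with h2 | h2
    · have a2 : djk ≤ 3 * Rj := by linarith
      have a3 : dkj * djk ≤ (3 * Rk) * (3 * Rj) := by gcongr
      have a4 : min 1 (R * Rj / (u * v)) ≤ 1 := min_le_left _ _
      have := mul_pos hRk0 hRj0
      have := mul_le_mul_of_nonneg_right a4 (mul_pos hkj0 hjk0).le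
      linarith
    · have a2 : djk ≤ 3 * u := by linarith
      have a3 : dkj * djk ≤ (3 * Rk) * (3 * u) := by gcongr
      have a4 : min 1 (R * Rj / (u * v)) ≤ Rj / u := by
        refine (min_le_right _ _).trans ?_
        rw [div_le_div_iff₀ (by positivity) hu]
        have : R ≤ v := by linarith
        have := mul_le_mul_of_nonneg_right this (mul_pos hRj0 hu).le
        linarith
      have := mul_pos hRk0 hRj0
      calc _ ≤ (Rj / u) * ((3 * Rk) * (3 * u)) := by gcongr
        _ = 9 * (Rk * Rj) := by field_simp; ring
        _ ≤ _ := by linarith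
  · have a1 : dkj ≤ 3 * u := by linarith
    have a2 : djk ≤ 5 * v := by linarith
    have a4 : min 1 (R * Rj / (u * v)) ≤ Rk * Rj / (u * v) := by
      refine (min_le_right _ _).trans ?_
      gcongr
    have := mul_pos hRk0 hRj0
    calc _ ≤ (Rk * Rj / (u * v)) * ((3 * u) * (5 * v)) := by gcongr
      _ = 15 * (Rk * Rj) := by field_simp; ring
      _ ≤ _ := by linarith

lemma aux_half {ι : Type v} [DecidableEq ι] (α : ℝ) (hα : 1 ≤ α) (e : ι → ι → ℝ)
    (ρ : ι → ℝ) (he : ∀ a b, 0 < e a b)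
    (hq : ∀ a b c d, e a b ≤ e a c + e d c + e d b) (hρ : ∀ a, e a a ≤ ρ a)
    (L J : Finset ι) (i : ι) (hJ : J ⊆ L) (h1 : ∀ j ∈ J, ρ i ≤ ρ j)
    (h2 : ∀ j ∈ J, e i j ≤ e j i)
    (hs : ∀ k ∈ L, ∑ j ∈ L.erase k, (ρ k * ρ j / (e k j * e j k)) ^ (α / 2) ≤ 3 / 2) :
    ∑ j ∈ J, min 1 ((ρ i * ρ j / (e i j * e j i)) ^ (α / 2))
      ≤ 1 + 16 ^ (α / 2) * (3 / 2) := by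
  have hρ0 : ∀ a, 0 < ρ a := fun a => (he a a).trans_le (hρ a)
  have hG : ∀ a b, 0 < ρ a * ρ b / (e a b * e b a) := fun a b =>
    div_pos (mul_pos (hρ0 _) (hρ0 _)) (mul_pos (he _ _) (he _ _))
  rcases J.eq_empty_or_nonempty with rfl | hne
  · simp only [sum_empty]; positivity
  obtain ⟨k, hk, hmin⟩ := J.exists_min_image (fun j => e i j) hne
  rw [← Finset.add_sum_erase _ _ hk]
  refine add_le_add (min_le_left _ _) ?_
  calc _ ≤ ∑ j ∈ J.erase k, 16 ^ (α / 2) * (ρ k * ρ j / (e k j * e j k)) ^ (α / 2) := by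
        refine sum_le_sum fun j hj => ?_
        have hj' := mem_of_mem_erase hj
        have b := aux_base (e i j) (e j i) (e i k) (ρ i) (ρ j) (ρ k) (e k j) (e j k)
          (e i i) (e j j) (e k k) (he _ _) (he _ _) (h2 j hj') (hmin j hj') (hρ0 i)
          (h1 j hj') (h1 k hk) (hρ _) (hρ _) (hρ _) (he _ _) (he _ _)
          (hq _ _ _ _) (by have := hq j k j i; linarith) (by have := hq j j i i; linarith)
        rw [← Real.mul_rpow (by norm_num) (hG k j).le]
        have c := Real.rpow_le_rpow (by have := hG i j; positivity) b
          (by linarith : (0:ℝ) ≤ α / 2)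
        refine le_trans ?_ c
        rcases le_total 1 (ρ i * ρ j / (e i j * e j i)) with h | h
        · rw [min_eq_left h, Real.one_rpow]; exact min_le_left _ _
        · rw [min_eq_right h]; exact min_le_right _ _
    _ ≤ ∑ j ∈ L.erase k, 16 ^ (α / 2) * (ρ k * ρ j / (e k j * e j k)) ^ (α / 2) := by
        refine sum_le_sum_of_subset_of_nonneg (erase_subset_erase _ hJ) fun j _ _ => ?_
        have := hG k j
        positivity
    _ ≤ _ := by
        rw [← mul_sum]
        exact mul_le_mul_of_nonneg_left (hs k (hJ hk)) (by positivity)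

/-- single term comparison: `R / v` against `G`, when `G ≤ 1`. -/
lemma aux_term (α u v R Rj : ℝ) (hα : 1 ≤ α) (hu : 0 < u) (hv : 0 < v) (hR : 0 < R)
    (hRj : R ≤ Rj) (h : u ≤ R + v + Rj) (hG : R * Rj / (u * v) ≤ 1) :
    (R / v) ^ α ≤ 3 ^ α * (R * Rj / (u * v)) ^ (α / 2) := by
  have hRj0 : 0 < Rj := by linarith
  have hG0 : 0 < R * Rj / (u * v) := by positivity
  have key : (R / v) ^ 2 ≤ 9 * (R * Rj / (u * v)) := by
    rcases le_or_gt v Rj with h1 | h1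
    · have h3 : R / v ≤ 3 * (R * Rj / (u * v)) := by
        rw [← mul_div_assoc, div_le_div_iff₀ hv (by positivity)]
        have : u ≤ 3 * Rj := by linarith
        have := mul_le_mul_of_nonneg_right this (mul_pos hR hv).le
        linarith
      have h0 : 0 ≤ R / v := by positivity
      nlinarith
    · have : u ≤ 3 * v := by linarith
      have : R / v * (R / v) ≤ 3 * (R * Rj / (u * v)) := by
        rw [div_mul_div_comm, ← mul_div_assoc, div_le_div_iff₀ (by positivity) (by positivity)]
        have h5 : R * R * (u * v) ≤ R * Rj * (3 * v * v) := by gcongr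
        linarith
      nlinarith
  have e1 : (R / v) ^ α = ((R / v) ^ 2) ^ (α / 2) := by
    rw [← Real.rpow_natCast, ← Real.rpow_mul (by positivity)]; congr 1; push_cast; ring
  have e2 : (3:ℝ) ^ α = 9 ^ (α / 2) := by
    rw [show (9:ℝ) = 3 ^ (2:ℝ) by norm_num, ← Real.rpow_mul (by positivity)]; congr 1; ring
  rw [e1, e2, ← Real.mul_rpow (by norm_num) hG0.le]
  exact Real.rpow_le_rpow (by positivity) key (by linarith)

lemma aux_weight (α u v R Rj : ℝ) (hα : 1 ≤ α) (hu : 0 < u) (hv : 0 < v) (hR : 0 < R)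
    (hRj : R ≤ Rj) (h : u ≤ R + v + Rj) (h' : v ≤ R + u + Rj) :
    min 1 (R ^ α * Rj ^ α / (u ^ α * v ^ α) + R ^ α / u ^ α + R ^ α / v ^ α)
      ≤ (1 + 2 * 3 ^ α) * min 1 ((R * Rj / (u * v)) ^ (α / 2)) := by
  have hRj0 : 0 < Rj := by linarith
  have hG0 : 0 < R * Rj / (u * v) := by positivity
  have h3 : (0:ℝ) ≤ 3 ^ α := by positivity
  rcases le_total 1 (R * Rj / (u * v)) with hG | hG
  · rw [min_eq_left (b := _ ^ (α / 2)) (Real.one_le_rpow hG (by linarith))]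
    refine (min_le_left _ _).trans (by linarith)
  · rw [min_eq_right (b := _ ^ (α / 2)) (Real.rpow_le_one hG0.le hG (by linarith))]
    refine (min_le_right _ _).trans ?_
    have t1 := aux_term α u v R Rj hα hu hv hR hRj h hG
    have t2 := aux_term α v u R Rj hα hv hu hR hRj h' (by rwa [mul_comm v u])
    rw [mul_comm v u] at t2
    have t3 : (R * Rj / (u * v)) ^ α ≤ (R * Rj / (u * v)) ^ (α / 2) :=
      Real.rpow_le_rpow_of_exponent_ge hG0 hG (by linarith)
    rw [← Real.mul_rpow hR.le hRj0.le, ← Real.mul_rpow hu.le hv.le,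
      ← Real.div_rpow (by positivity) (by positivity), ← Real.div_rpow hR.le hu.le,
      ← Real.div_rpow hR.le hv.le]
    linarith

/-- selection of the subset -/
lemma aux_select {ι : Type v} [DecidableEq ι] (L : Finset ι) (M : ι → ι → ℝ)
    (hM : ∀ i ∈ L, ∀ j ∈ L, 0 ≤ M i j) (hrow : ∀ i ∈ L, ∑ j ∈ L.erase i, M i j ≤ 1) :
    ∃ L' ⊆ L, (1 / 2 : ℝ) * L.card ≤ L'.card ∧
      ∀ k ∈ L', ∑ j ∈ L'.erase k, (M k j + M j k) / 2 ≤ 3 / 2 := by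
  classical
  let P : ι → Prop := fun j => ∑ i ∈ L.erase j, M i j ≤ 2
  refine ⟨L.filter P, filter_subset _ _, ?_, ?_⟩
  · have htot : ∑ j ∈ L, ∑ i ∈ L.erase j, M i j ≤ L.card := by
      have : ∑ j ∈ L, ∑ i ∈ L.erase j, M i j = ∑ i ∈ L, ∑ j ∈ L.erase i, M i j := by
        refine Finset.sum_comm' fun a b => ?_
        simp only [mem_erase]
        tauto
      rw [this]
      calc _ ≤ ∑ i ∈ L, (1:ℝ) := sum_le_sum hrow
        _ = _ := by simp
    have hbad : (2:ℝ) * (L.filter (fun j => ¬ P j)).card ≤ L.card := by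
      calc (2:ℝ) * (L.filter (fun j => ¬ P j)).card
          = ∑ j ∈ L.filter (fun j => ¬ P j), (2:ℝ) := by simp [mul_comm]
        _ ≤ ∑ j ∈ L.filter (fun j => ¬ P j), ∑ i ∈ L.erase j, M i j := by
            refine sum_le_sum fun j hj => ?_
            exact (not_le.1 (mem_filter.1 hj).2).le
        _ ≤ ∑ j ∈ L, ∑ i ∈ L.erase j, M i j := by
            refine sum_le_sum_of_subset_of_nonneg (filter_subset _ _) fun j hj _ => ?_
            exact sum_nonneg fun i hi => hM i (mem_of_mem_erase hi) j hj
        _ ≤ _ := htot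
    have hc : ((L.filter P).card : ℝ) + (L.filter (fun j => ¬ P j)).card = L.card := by
      exact_mod_cast card_filter_add_card_filter_not (s := L) P
    linarith
  · intro k hk
    have hkL := (mem_filter.1 hk).1
    have hkP : ∑ i ∈ L.erase k, M i k ≤ 2 := (mem_filter.1 hk).2
    calc _ ≤ ∑ j ∈ L.erase k, (M k j + M j k) / 2 := by
          refine sum_le_sum_of_subset_of_nonneg
            (erase_subset_erase _ (filter_subset _ _)) fun j hj _ => ?_
          have := hM k hkL j (mem_of_mem_erase hj)
          have := hM j (mem_of_mem_erase hj) k hkL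
          linarith
      _ = (∑ j ∈ L.erase k, M k j + ∑ j ∈ L.erase k, M j k) / 2 := by
          rw [← sum_div, sum_add_distrib]
      _ ≤ _ := by have := hrow k hkL; linarith

/-- Characterization of admissible sets: there are constants `c₁ ∈ (0,1]` and `C ≥ 0`
depending only on `α` such that every admissible set `L` has a subset `L'` with
`|L'| ≥ c₁·|L|` whose incoming weight `Σ_{ℓ'∈L'} w(ℓ,ℓ')` is at most `C` for
every link `ℓ` of the ground set. -/
theorem admissible_set_characterization (α : ℝ) (hα : 1 ≤ α) :
    ∃ c₁ C : ℝ, 0 < c₁ ∧ c₁ ≤ 1 ∧ 0 ≤ C ∧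
      ∀ (X : Type u) (ι : Type v) [MetricSpace X] [Fintype ι] [DecidableEq ι]
        (N : ℝ) (s r : ι → X) (β : ι → ℝ) (π : ι → ℕ),
        0 < N →
        (∀ i, 1 ≤ β i) →
        (∀ i, 0 < dist (s i) (r i)) →
        (∀ i j, i ≠ j → 0 < dist (s i) (r j)) →
        Function.Injective π →
        (∀ i j, π i < π j →
          β j * dist (s j) (r j) ^ α ≤ β i * dist (s i) (r i) ^ α) →
        ∀ L : Finset ι, Admissible α N s r β L →
          ∃ L' ⊆ L, c₁ * (L.card : ℝ) ≤ (L'.card : ℝ) ∧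
            ∀ i : ι, ∑ j ∈ L', weight α s r β π i j ≤ C := by
  refine ⟨1 / 2, (1 + 2 * 3 ^ α) * (2 * (1 + 16 ^ (α / 2) * (3 / 2))), by norm_num,
    by norm_num, by positivity, ?_⟩
  intro X ι _ _ _ N s r β π hN hβ hd hsr hπ hord L ⟨p, hp, hL⟩
  have hα0 : 0 < α := by linarith
  set e : ι → ι → ℝ := fun a b => dist (s a) (r b) with hedef
  have he : ∀ a b, 0 < e a b := by
    intro a b
    by_cases h : a = b
    · subst h; exact hd a
    · exact hsr a b h
  have hq : ∀ a b c d, e a b ≤ e a c + e d c + e d b := by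
    intro a b c d
    have := dist_triangle4 (s a) (r c) (s d) (r b)
    rw [dist_comm (r c) (s d)] at this
    exact this
  let ρ : ι → ℝ := fun a => β a ^ (1 / α) * e a a
  have hβ0 : ∀ a, 0 < β a := fun a => by linarith [hβ a]
  have hρ : ∀ a, e a a ≤ ρ a := fun a =>
    le_mul_of_one_le_left (he a a).le (Real.one_le_rpow (hβ a) (by positivity))
  have hρ0 : ∀ a, 0 < ρ a := fun a => (he a a).trans_le (hρ a)
  have hρα : ∀ a, ρ a ^ α = β a * e a a ^ α := by
    intro a
    change (β a ^ (1 / α) * e a a) ^ α = _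
    rw [Real.mul_rpow (by have := hβ0 a; positivity) (he a a).le,
      ← Real.rpow_mul (hβ0 a).le, one_div_mul_cancel hα0.ne', Real.rpow_one]
  have heα : ∀ a b, 0 < e a b ^ α := fun a b => Real.rpow_pos_of_pos (he a b) _
  have hραpos : ∀ a, 0 < ρ a ^ α := fun a => Real.rpow_pos_of_pos (hρ0 a) _
  -- consequences of admissibility
  have hpow : ∀ i ∈ L, ρ i ^ α * ((∑ j ∈ L.erase i, p j / e j i ^ α) + N) ≤ p i := by
    intro i hi
    have h := hL i hi
    have hS : 0 ≤ ∑ j ∈ L.erase i, p j / e j i ^ α :=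
      sum_nonneg fun j hj => div_nonneg (hp j (mem_of_mem_erase hj)) (heα _ _).le
    have h2 : β i * ((∑ j ∈ L.erase i, p j / e j i ^ α) + N) ≤ p i / e i i ^ α :=
      (le_div_iff₀ (by linarith)).1 h
    rw [le_div_iff₀ (heα i i)] at h2
    rw [hρα]; linarith
  have hp0 : ∀ i ∈ L, 0 < p i := by
    intro i hi
    have hS : 0 ≤ ∑ j ∈ L.erase i, p j / e j i ^ α :=
      sum_nonneg fun j hj => div_nonneg (hp j (mem_of_mem_erase hj)) (heα _ _).le
    exact (mul_pos (hραpos i) (by linarith)).trans_le (hpow i hi)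
  obtain ⟨L', hL'L, hcard, hsel⟩ := aux_select L
    (fun i j => ρ i ^ α * p j / (e j i ^ α * p i))
    (fun i hi j hj => by
      have := hp0 i hi; have := hp0 j hj; have := heα j i; have := hραpos i
      positivity)
    (fun i hi => by
      have h := hpow i hi
      have hpi := hp0 i hi
      have : ∑ j ∈ L.erase i, ρ i ^ α * p j / (e j i ^ α * p i)
          = ρ i ^ α * (∑ j ∈ L.erase i, p j / e j i ^ α) / p i := by
        rw [mul_sum, sum_div]
        refine sum_congr rfl fun j _ => ?_
        have := (heα j i).ne'
        field_simp
      rw [this, div_le_one hpi]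
      have := mul_pos (hραpos i) hN
      linarith)
  refine ⟨L', hL'L, hcard, ?_⟩
  have hG : ∀ a b, 0 < ρ a * ρ b / (e a b * e b a) := fun a b =>
    div_pos (mul_pos (hρ0 _) (hρ0 _)) (mul_pos (he _ _) (he _ _))
  have hs : ∀ k ∈ L', ∑ j ∈ L'.erase k, (ρ k * ρ j / (e k j * e j k)) ^ (α / 2) ≤ 3 / 2 := by
    intro k hk
    refine le_trans (sum_le_sum fun j hj => ?_) (hsel k hk)
    have hpk := hp0 k (hL'L hk)
    have hpj := hp0 j (hL'L (mem_of_mem_erase hj))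
    have e1 := heα j k
    have e2 := heα k j
    have r1 := hραpos k
    have r2 := hραpos j
    have hx : 0 ≤ ρ k ^ α * p j / (e j k ^ α * p k) := by positivity
    have hy : 0 ≤ ρ j ^ α * p k / (e k j ^ α * p j) := by positivity
    have hz : 0 ≤ (ρ k * ρ j / (e k j * e j k)) ^ (α / 2) :=
      Real.rpow_nonneg (hG k j).le _
    have hsq : ((ρ k * ρ j / (e k j * e j k)) ^ (α / 2)) ^ 2
        = ρ k ^ α * p j / (e j k ^ α * p k) * (ρ j ^ α * p k / (e k j ^ α * p j)) := by
      rw [← Real.rpow_natCast, ← Real.rpow_mul (hG k j).le,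
        show α / 2 * ((2:ℕ):ℝ) = α by push_cast; ring,
        Real.div_rpow (mul_pos (hρ0 _) (hρ0 _)).le (mul_pos (he _ _) (he _ _)).le,
        Real.mul_rpow (hρ0 _).le (hρ0 _).le, Real.mul_rpow (he _ _).le (he _ _).le]
      field_simp
    refine abs_le_of_sq_le_sq' ?_ (by positivity) |>.2
    rw [hsq]
    generalize ρ k ^ α * p j / (e j k ^ α * p k) = x
    generalize ρ j ^ α * p k / (e k j ^ α * p j) = y
    nlinarith [sq_nonneg (x - y)]
  intro i
  let J := L'.filter (fun j => π j < π i)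
  have hJ : ∀ j ∈ J, ρ i ≤ ρ j := by
    intro j hj
    have := hord j i (mem_filter.1 hj).2
    refine (Real.rpow_le_rpow_iff (hρ0 i).le (hρ0 j).le hα0).1 ?_
    rw [hρα, hρα]; exact this
  let g : ι → ℝ := fun j => min 1 ((ρ i * ρ j / (e i j * e j i)) ^ (α / 2))
  have A1 : ∑ j ∈ L', weight α s r β π i j ≤ ∑ j ∈ J, (1 + 2 * 3 ^ α) * g j := by
    rw [sum_filter]
    refine sum_le_sum fun j hj => ?_
    unfold weight
    split_ifs with hlt
    · have w := aux_weight α (e i j) (e j i) (ρ i) (ρ j) hα (he _ _) (he _ _) (hρ0 i)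
        (hJ j (mem_filter.2 ⟨hj, hlt⟩))
        (by have := hq i j i j; linarith [hρ i, hρ j])
        (by have := hq j i j i; linarith [hρ i, hρ j])
      refine le_trans (le_of_eq ?_) w
      rw [hρα, hρα]
      simp only [hedef]
      congr 4
      ring
    · exact le_rfl
  refine A1.trans ?_
  rw [← mul_sum]
  refine mul_le_mul_of_nonneg_left ?_ (by positivity)
  rw [← sum_filter_add_sum_filter_not J (fun j => e i j ≤ e j i), two_mul]
  refine add_le_add ?_ ?_
  · exact aux_half α hα e ρ he hq hρ L' _ i
      ((filter_subset _ _).trans (filter_subset _ _))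
      (fun j hj => hJ j (mem_filter.1 hj).1) (fun j hj => (mem_filter.1 hj).2) hs
  · have := aux_half α hα (fun a b => e b a) ρ (fun a b => he b a)
      (fun a b c d => by have := hq b a d c; linarith) hρ L'
      (J.filter (fun j => ¬ e i j ≤ e j i)) i
      ((filter_subset _ _).trans (filter_subset _ _))
      (fun j hj => hJ j (mem_filter.1 hj).1)
      (fun j hj => (not_le.1 (mem_filter.1 hj).2).le)
      (fun k hk => by
        refine le_trans (le_of_eq (sum_congr rfl fun j _ => ?_)) (hs k hk)
        rw [mul_comm (e j k)])
    refine le_trans (le_of_eq (sum_congr rfl fun j _ => ?_)) this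
    simp only [g]
    rw [mul_comm (e j i)]
end

section
/- There exist constants c₁ ∈ (0,1] and C ≥ 0 depending only on α such that for every finite admissible set of links L there is a subset L' ⊆ L with |L'| ≥ c₁·|L| and Σ_{ℓ=(s,r)∈L'} Σ_{ℓ'=(s',r')∈L', π(ℓ') > π(ℓ)} β(ℓ')·dist(s',r')^α / dist(s',r)^α ≤ C·|L'|. -/
open Finset

universe u v

lemma pair_aux (T a b U V P Q : ℝ) (hT : 1 ≤ T) (hb : 0 < b) (hba : b ≤ a) (hU : 0 < U)
    (hV : 0 < V) (hP : 0 < P) (hQ : 0 < Q) (hVm : V ≤ T * max U a)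
    (h1 : a * (Q / U) / P ≤ 1) (h2 : b * (P / V) / Q ≤ 1) :
    b / U ≤ T ^ 2 * (a * (Q / U) / P + b * (P / V) / Q) := by
  have ha : 0 < a := hb.trans_le hba
  have e1 : 0 < a * (Q / U) / P := by positivity
  have e2 : 0 < b * (P / V) / Q := by positivity
  have hT2 : 1 ≤ T ^ 2 := by nlinarith
  have hTT : T ≤ T ^ 2 := by nlinarith
  rcases le_total (P * b) (Q * a) with h | h
  · have : b / U ≤ a * (Q / U) / P := by
      rw [le_div_iff₀ hP, div_mul_eq_mul_div, mul_div_assoc', div_le_div_iff_of_pos_right hU]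
      linarith
    nlinarith
  · have h3 : a / V ≤ b * (P / V) / Q := by
      rw [le_div_iff₀ hQ, div_mul_eq_mul_div, mul_div_assoc', div_le_div_iff_of_pos_right hV]
      linarith
    have h4 : b / U ≤ T ^ 2 * (a / V) := by
      rcases le_total a U with hu | hu
      · rw [max_eq_left hu] at hVm
        rw [mul_div_assoc', div_le_div_iff₀ hU hV]
        calc b * V ≤ a * (T * U) := by gcongr
          _ = T * (a * U) := by ring
          _ ≤ T ^ 2 * (a * U) := by gcongr
          _ = _ := by ring
      · rw [max_eq_right hu] at hVm
        have hp : a * b / (U * V) ≤ 1 := by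
          calc a * b / (U * V) = (a * (Q / U) / P) * (b * (P / V) / Q) := by field_simp
            _ ≤ 1 := mul_le_one₀ h1 e2.le h2
        rw [div_le_one (by positivity)] at hp
        rw [mul_div_assoc', div_le_div_iff₀ hU hV]
        have : a * (b * V) ≤ a * (T ^ 2 * a * U) := by
          calc a * (b * V) = (a * b) * V := by ring
            _ ≤ (U * V) * V := by gcongr
            _ = U * V ^ 2 := by ring
            _ ≤ U * (T * a) ^ 2 := by gcongr
            _ = _ := by ring
        exact le_of_mul_le_mul_left this ha
    have : T ^ 2 * (a / V) ≤ T ^ 2 * (b * (P / V) / Q) := by gcongr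
    nlinarith

lemma dist_aux (α a di dj D D' : ℝ) (hα : 1 ≤ α) (hdi : 0 ≤ di) (hdj : 0 ≤ dj) (hD : 0 ≤ D)
    (hD' : 0 ≤ D') (hai : di ^ α ≤ a) (haj : dj ^ α ≤ a) (h : D' ≤ D + di + dj) :
    D' ^ α ≤ 3 ^ α * max (D ^ α) a := by
  have hα0 : 0 < α := by linarith
  have hm : ∃ m, 0 ≤ m ∧ D' ≤ 3 * m ∧ m ^ α ≤ max (D ^ α) a := by
    rcases le_total D (max di dj) with h1 | h1
    · refine ⟨max di dj, le_max_of_le_left hdi, ?_, le_max_of_le_right ?_⟩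
      · linarith [le_max_left di dj, le_max_right di dj]
      · rcases max_choice di dj with h2 | h2 <;> rw [h2] <;> assumption
    · exact ⟨D, hD, by linarith [le_max_left di dj, le_max_right di dj], le_max_left _ _⟩
  obtain ⟨m, hm0, h1, h2⟩ := hm
  calc D' ^ α ≤ (3 * m) ^ α := Real.rpow_le_rpow hD' h1 hα0.le
    _ = 3 ^ α * m ^ α := Real.mul_rpow (by norm_num) hm0
    _ ≤ _ := by gcongr

/-- Claim: there are constants `c₁ ∈ (0,1]`, `C ≥ 0` depending only on `α` such
that every admissible set `L` has a subset `L'` with `|L'| ≥ c₁·|L|` and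
`Σ_{ℓ∈L'} Σ_{ℓ'∈L', π(ℓ')>π(ℓ)} β(ℓ')·d(s',r')^α/d(s',r)^α ≤ C·|L'|`. -/
theorem admissible_double_sum_bound (α : ℝ) (hα : 1 ≤ α) :
    ∃ c₁ C : ℝ, 0 < c₁ ∧ c₁ ≤ 1 ∧ 0 ≤ C ∧
      ∀ (X : Type u) (ι : Type v) [MetricSpace X] [Fintype ι] [DecidableEq ι]
        (N : ℝ) (s r : ι → X) (β : ι → ℝ) (π : ι → ℕ),
        0 < N →
        (∀ i, 1 ≤ β i) →
        (∀ i, 0 < dist (s i) (r i)) →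
        (∀ i j, i ≠ j → 0 < dist (s i) (r j)) →
        Function.Injective π →
        (∀ i j, π i < π j →
          β j * dist (s j) (r j) ^ α ≤ β i * dist (s i) (r i) ^ α) →
        ∀ L : Finset ι, Admissible α N s r β L →
          ∃ L' ⊆ L, c₁ * (L.card : ℝ) ≤ (L'.card : ℝ) ∧
            ∑ i ∈ L', ∑ j ∈ L'.filter (fun j => π i < π j),
                β j * dist (s j) (r j) ^ α / dist (s j) (r i) ^ α
              ≤ C * (L'.card : ℝ) := by
  refine ⟨1, 2 * (3 ^ α) ^ 2, one_pos, le_rfl, by positivity, ?_⟩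
  intro X ι _ _ _ N s r β π hN hβ hd hD hπ hord L ⟨p, hp0, hp⟩
  have hα0 : 0 < α := by linarith
  have hT : (1 : ℝ) ≤ 3 ^ α := Real.one_le_rpow (by norm_num) hα0.le
  refine ⟨L, Subset.refl _, by simp, ?_⟩
  have hsum0 : ∀ i, 0 ≤ ∑ j ∈ L.erase i, p j / dist (s j) (r i) ^ α := fun i =>
    Finset.sum_nonneg fun j hj => div_nonneg (hp0 j (Finset.mem_of_mem_erase hj)) (by positivity)
  have hdα : ∀ i, 0 < dist (s i) (r i) ^ α := fun i => Real.rpow_pos_of_pos (hd i) _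
  have hw : ∀ i, 0 < β i * dist (s i) (r i) ^ α := fun i =>
    mul_pos (by linarith [hβ i]) (hdα i)
  have hmain : ∀ i ∈ L, β i * dist (s i) (r i) ^ α *
      ((∑ j ∈ L.erase i, p j / dist (s j) (r i) ^ α) + N) ≤ p i := by
    intro i hi
    have h := hp i hi
    unfold sinr at h
    rw [le_div_iff₀ (by linarith [hsum0 i]), le_div_iff₀ (hdα i)] at h
    linarith
  have hpp : ∀ i ∈ L, 0 < p i := fun i hi =>
    lt_of_lt_of_le (mul_pos (hw i) (by linarith [hsum0 i])) (hmain i hi)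
  let E : ι → ι → ℝ := fun i j =>
    β i * dist (s i) (r i) ^ α * (p j / dist (s j) (r i) ^ α) / p i
  have hE0 : ∀ i ∈ L, ∀ j ∈ L, 0 ≤ E i j := fun i hi j hj =>
    div_nonneg (mul_nonneg (hw i).le (div_nonneg (hp0 j hj) (by positivity))) (hp0 i hi)
  have hEsum : ∀ i ∈ L, ∑ j ∈ L.erase i, E i j ≤ 1 := by
    intro i hi
    have h := hmain i hi
    simp only [E]
    rw [← Finset.sum_div, ← Finset.mul_sum, div_le_one (hpp i hi)]
    nlinarith [mul_pos (hw i) hN]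
  have hE1 : ∀ i ∈ L, ∀ j ∈ L, j ≠ i → E i j ≤ 1 := fun i hi j hj hji =>
    (Finset.single_le_sum (f := fun j => E i j)
      (fun k hk => hE0 i hi k (Finset.mem_of_mem_erase hk))
      (Finset.mem_erase.2 ⟨hji, hj⟩)).trans (hEsum i hi)
  have hpair : ∀ i ∈ L, ∀ j ∈ L, π i < π j →
      β j * dist (s j) (r j) ^ α / dist (s j) (r i) ^ α ≤ (3 ^ α) ^ 2 * (E i j + E j i) := by
    intro i hi j hj hij
    have hne : i ≠ j := by rintro rfl; exact lt_irrefl _ hij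
    have hle : ∀ k, dist (s k) (r k) ^ α ≤ β k * dist (s k) (r k) ^ α := fun k =>
      le_mul_of_one_le_left (hdα k).le (hβ k)
    refine pair_aux _ _ _ _ _ _ _ hT (hw j) (hord i j hij)
      (Real.rpow_pos_of_pos (hD j i hne.symm) _) (Real.rpow_pos_of_pos (hD i j hne) _)
      (hpp i hi) (hpp j hj) ?_ (hE1 i hi j hj hne.symm) (hE1 j hj i hi hne)
    refine dist_aux α _ (dist (s i) (r i)) (dist (s j) (r j)) _ _ hα dist_nonneg dist_nonneg
      dist_nonneg dist_nonneg (hle i) ((hle j).trans (hord i j hij)) ?_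
    have h1 := dist_triangle4 (s i) (r i) (s j) (r j)
    rw [dist_comm (r i) (s j)] at h1
    linarith
  have hsumle : ∀ (i : ι) (hi : i ∈ L) (q : ι → Prop) [DecidablePred q], ¬ q i →
      ∑ j ∈ L.filter q, E i j ≤ 1 := by
    intro i hi q _ hq
    refine (Finset.sum_le_sum_of_subset_of_nonneg ?_ ?_).trans (hEsum i hi)
    · intro j hj
      rw [Finset.mem_filter] at hj
      refine Finset.mem_erase.2 ⟨?_, hj.1⟩
      rintro rfl
      exact hq hj.2
    · intro j hj _
      exact hE0 i hi j (Finset.mem_of_mem_erase hj)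
  have hA : ∑ i ∈ L, ∑ j ∈ L.filter (fun j => π i < π j), E i j ≤ (L.card : ℝ) := by
    calc _ ≤ ∑ i ∈ L, (1 : ℝ) :=
          Finset.sum_le_sum fun i hi => hsumle i hi (fun k => π i < π k) (lt_irrefl (π i))
      _ = _ := by simp
  have hB : ∑ i ∈ L, ∑ j ∈ L.filter (fun j => π i < π j), E j i ≤ (L.card : ℝ) := by
    calc _ = ∑ j ∈ L, ∑ i ∈ L.filter (fun i => π i < π j), E j i := by
          simp only [Finset.sum_filter]
          exact Finset.sum_comm
      _ ≤ ∑ i ∈ L, (1 : ℝ) :=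
          Finset.sum_le_sum fun i hi => hsumle i hi (fun k => π k < π i) (lt_irrefl (π i))
      _ = _ := by simp
  calc _ ≤ ∑ i ∈ L, ∑ j ∈ L.filter (fun j => π i < π j), (3 ^ α) ^ 2 * (E i j + E j i) := by
        refine Finset.sum_le_sum fun i hi => Finset.sum_le_sum fun j hj => ?_
        rw [Finset.mem_filter] at hj
        exact hpair i hi j hj.1 hj.2
    _ = (3 ^ α) ^ 2 * (∑ i ∈ L, ∑ j ∈ L.filter (fun j => π i < π j), E i j
          + ∑ i ∈ L, ∑ j ∈ L.filter (fun j => π i < π j), E j i) := by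
        simp only [← Finset.mul_sum, Finset.sum_add_distrib]
    _ ≤ (3 ^ α) ^ 2 * ((L.card : ℝ) + L.card) := by gcongr
    _ = _ := by ring
end

section
/- There exist constants c₁ ∈ (0,1] and C ≥ 0 depending only on α such that for every finite admissible set of links L there is a subset L' ⊆ L with |L'| ≥ c₁·|L| and, for every ℓ = (s,r) ∈ L', Σ_{ℓ'=(s',r')∈L', ℓ'≠ℓ} min{β(ℓ)·dist(s,r)^α, β(ℓ')·dist(s',r')^α} / min{dist(s',r)^α, dist(s,r')^α} ≤ C. -/
open Finset

universe u v

lemma aux_real {a b x y : ℝ} (ha : 0 < a) (hab : a ≤ b) (hx : 0 < x) (hy : 0 < y)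
    (hxy : a * b ≤ x * y) (h1 : x ≤ y + a + b) : a * x ≤ 7 * (b * y) := by
  by_cases h : a / 3 ≤ y
  · nlinarith [mul_le_mul_of_nonneg_left h (by linarith : (0:ℝ) ≤ b), mul_le_mul_of_nonneg_right hab hy.le,
      mul_le_mul_of_nonneg_left hab ha.le]
  · push Not at h
    exfalso
    have h3 : x < 3 * b := by linarith
    nlinarith

lemma aux_pow {α a b x y : ℝ} (hα : 1 ≤ α) (ha : 0 < a) (hb : 0 < b) (hx : 0 < x) (hy : 0 < y)
    (hab : a ^ α ≤ b ^ α) (hxy : a ^ α * b ^ α ≤ x ^ α * y ^ α) (h1 : x ≤ y + a + b) :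
    a ^ α * x ^ α ≤ 7 ^ α * (b ^ α * y ^ α) := by
  have h0 : 0 < α := by linarith
  rw [← Real.mul_rpow ha.le hb.le, ← Real.mul_rpow hx.le hy.le,
    Real.rpow_le_rpow_iff (by positivity) (by positivity) h0] at hxy
  rw [Real.rpow_le_rpow_iff ha.le hb.le h0] at hab
  rw [← Real.mul_rpow ha.le hx.le, ← Real.mul_rpow hb.le hy.le,
    ← Real.mul_rpow (by norm_num) (by positivity)]
  exact Real.rpow_le_rpow (by positivity) (aux_real ha hab hx hy hxy h1) h0.le

lemma aux_div {K a b x y : ℝ} (ha : 0 < a) (hx : 0 < x) (hy : 0 < y)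
    (h : a * y ≤ K * (b * x)) : (a / x) ^ 2 ≤ K * ((a / x) * (b / y)) := by
  rw [div_pow, div_mul_div_comm, ← mul_div_assoc, div_le_div_iff₀ (by positivity) (by positivity)]
  nlinarith [mul_le_mul_of_nonneg_left h (by positivity : 0 ≤ a * x)]

lemma aux_min {α a b x y : ℝ} (hα : 1 ≤ α) (ha : 0 < a) (hb : 0 < b) (hx : 0 < x) (hy : 0 < y)
    (hxy : a ^ α * b ^ α ≤ x ^ α * y ^ α) (h1 : x ≤ y + a + b) (h2 : y ≤ x + a + b) :
    (min (a ^ α) (b ^ α) / min (x ^ α) (y ^ α)) ^ 2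
      ≤ 7 ^ α * ((a ^ α / x ^ α) * (b ^ α / y ^ α)) := by
  have hA := Real.rpow_pos_of_pos ha α
  have hB := Real.rpow_pos_of_pos hb α
  have hX := Real.rpow_pos_of_pos hx α
  have hY := Real.rpow_pos_of_pos hy α
  rcases le_total (a ^ α) (b ^ α) with h | h
  · have e1 := aux_pow hα ha hb hx hy h hxy h1
    have e2 := aux_pow hα ha hb hy hx h (by linarith) h2
    rw [min_eq_left h]
    rcases le_total (x ^ α) (y ^ α) with g | g
    · rw [min_eq_left g]
      exact aux_div hA hX hY e2
    · rw [min_eq_right g]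
      refine (aux_div hA hY hX e1).trans (le_of_eq ?_)
      field_simp
  · have e1 := aux_pow hα hb ha hx hy h (by linarith) (by linarith)
    have e2 := aux_pow hα hb ha hy hx h (by linarith) (by linarith)
    rw [min_eq_right h]
    rcases le_total (x ^ α) (y ^ α) with g | g
    · rw [min_eq_left g]
      refine (aux_div hB hX hY e2).trans (le_of_eq ?_)
      field_simp
    · rw [min_eq_right g]
      refine (aux_div hB hY hX e1).trans (le_of_eq ?_)
      field_simp

/-- The pairwise bound. -/
lemma aux_pair {X : Type*} [MetricSpace X] {α : ℝ} (hα : 1 ≤ α) (s r s' r' : X) {β β' p p' : ℝ}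
    (hβ : 1 ≤ β) (hβ' : 1 ≤ β') (hp : 0 < p) (hp' : 0 < p')
    (h : 0 < dist s r) (h' : 0 < dist s' r') (hx : 0 < dist s' r) (hy : 0 < dist s r')
    (h1 : β * dist s r ^ α * (p' / dist s' r ^ α) ≤ p)
    (h2 : β' * dist s' r' ^ α * (p / dist s r' ^ α) ≤ p') :
    min (β * dist s r ^ α) (β' * dist s' r' ^ α) / min (dist s' r ^ α) (dist s r' ^ α)
      ≤ 7 ^ α * (β * dist s r ^ α * (p' / dist s' r ^ α) / p +
          β' * dist s' r' ^ α * (p / dist s r' ^ α) / p') := by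
  have h0 : 0 < α := by linarith
  have key : ∀ {β d : ℝ}, 1 ≤ β → 0 < d → ∃ a, d ≤ a ∧ a ^ α = β * d ^ α := by
    intro β d hβ hd
    refine ⟨β ^ α⁻¹ * d, ?_, ?_⟩
    · have := Real.one_le_rpow hβ (inv_nonneg.2 h0.le)
      nlinarith
    · rw [Real.mul_rpow (by positivity) hd.le, Real.rpow_inv_rpow (by linarith) h0.ne']
  obtain ⟨a, ha, hae⟩ := key hβ h
  obtain ⟨b, hb, hbe⟩ := key hβ' h'
  rw [← hae] at h1 ⊢
  rw [← hbe] at h2 ⊢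
  have ha0 : 0 < a := by linarith
  have hb0 : 0 < b := by linarith
  have hA := Real.rpow_pos_of_pos ha0 α
  have hB := Real.rpow_pos_of_pos hb0 α
  have hX := Real.rpow_pos_of_pos hx α
  have hY := Real.rpow_pos_of_pos hy α
  have hK : (1:ℝ) ≤ 7 ^ α := Real.one_le_rpow (by norm_num) h0.le
  have t1 : dist s' r ≤ dist s r' + a + b := by
    have := dist_triangle4 s' r' s r
    rw [dist_comm r' s] at this
    linarith
  have t2 : dist s r' ≤ dist s' r + a + b := by
    have := dist_triangle4 s r s' r'
    rw [dist_comm r s'] at this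
    linarith
  have hprod : a ^ α * b ^ α ≤ dist s' r ^ α * dist s r' ^ α := by
    have := mul_le_mul h1 h2 (by positivity) hp.le
    have e : a ^ α * (p' / dist s' r ^ α) * (b ^ α * (p / dist s r' ^ α))
        = (a ^ α * b ^ α) / (dist s' r ^ α * dist s r' ^ α) * (p * p') := by
      field_simp
    rw [e] at this
    have h3 : (a ^ α * b ^ α) / (dist s' r ^ α * dist s r' ^ α) ≤ 1 :=
      le_of_mul_le_mul_right (by linarith) (mul_pos hp hp')
    rwa [div_le_one (by positivity)] at h3
  have hm := aux_min hα ha0 hb0 hx hy hprod t1 t2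
  set u := a ^ α * (p' / dist s' r ^ α) / p with hu
  set v := b ^ α * (p / dist s r' ^ α) / p' with hv
  have hu0 : 0 < u := by positivity
  have hv0 : 0 < v := by positivity
  have huv : a ^ α / dist s' r ^ α * (b ^ α / dist s r' ^ α) = u * v := by
    rw [hu, hv]; field_simp
  rw [huv] at hm
  refine le_of_sq_le_sq (hm.trans ?_) (by positivity)
  have : (7:ℝ) ^ α ≤ (7 ^ α) ^ 2 := by nlinarith
  calc (7:ℝ) ^ α * (u * v) ≤ (7 ^ α) ^ 2 * (u + v) ^ 2 :=
        mul_le_mul this (by nlinarith) (by positivity) (by positivity)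
    _ = _ := by ring

/-- Averaging: half of the rows have at most twice the average. -/
lemma aux_avg {ι : Type*} [DecidableEq ι] (L : Finset ι) (f : ι → ℝ) (C : ℝ) (hC : 0 < C)
    (hf : ∀ i ∈ L, 0 ≤ f i) (h : ∑ i ∈ L, f i ≤ C * L.card) :
    (1 / 2 : ℝ) * L.card ≤ ((L.filter (fun i => f i ≤ 2 * C)).card : ℝ) := by
  have h1 : (2 * C) * ((L.filter (fun i => ¬ f i ≤ 2 * C)).card : ℝ) ≤ ∑ i ∈ L, f i := by
    calc _ = ∑ i ∈ L.filter (fun i => ¬ f i ≤ 2 * C), (2 * C) := by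
          rw [sum_const, nsmul_eq_mul]; ring
      _ ≤ ∑ i ∈ L.filter (fun i => ¬ f i ≤ 2 * C), f i :=
          sum_le_sum fun i hi => (not_le.1 (mem_filter.1 hi).2).le
      _ ≤ _ := sum_le_sum_of_subset_of_nonneg (filter_subset _ _) fun i hi _ => hf i hi
  have h2 : ((L.filter (fun i => f i ≤ 2 * C)).card : ℝ)
      + ((L.filter (fun i => ¬ f i ≤ 2 * C)).card : ℝ) = L.card := by
    exact_mod_cast card_filter_add_card_filter_not (s := L) (fun i => f i ≤ 2 * C)
  have h3 : C * (2 * ((L.filter (fun i => ¬ f i ≤ 2 * C)).card : ℝ)) ≤ C * L.card := by linarith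
  have := le_of_mul_le_mul_left h3 hC
  linarith

/-- Claim: there are constants `c₁ ∈ (0,1]`, `C ≥ 0` depending only on `α` such
that every admissible set `L` has a subset `L'` with `|L'| ≥ c₁·|L|` and, for every
`ℓ ∈ L'`, `Σ_{ℓ'∈L', ℓ'≠ℓ} min{β(ℓ)d(s,r)^α, β(ℓ')d(s',r')^α} / min{d(s',r)^α, d(s,r')^α} ≤ C`. -/
theorem admissible_min_sum_bound (α : ℝ) (hα : 1 ≤ α) :
    ∃ c₁ C : ℝ, 0 < c₁ ∧ c₁ ≤ 1 ∧ 0 ≤ C ∧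
      ∀ (X : Type u) (ι : Type v) [MetricSpace X] [Fintype ι] [DecidableEq ι]
        (N : ℝ) (s r : ι → X) (β : ι → ℝ),
        0 < N →
        (∀ i, 1 ≤ β i) →
        (∀ i, 0 < dist (s i) (r i)) →
        (∀ i j, i ≠ j → 0 < dist (s i) (r j)) →
        ∀ L : Finset ι, Admissible α N s r β L →
          ∃ L' ⊆ L, c₁ * (L.card : ℝ) ≤ (L'.card : ℝ) ∧
            ∀ i ∈ L', ∑ j ∈ L'.erase i,
                min (β i * dist (s i) (r i) ^ α) (β j * dist (s j) (r j) ^ α) /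
                  min (dist (s j) (r i) ^ α) (dist (s i) (r j) ^ α)
              ≤ C := by
  refine ⟨1 / 2, 2 * (2 * 7 ^ α), by norm_num, by norm_num, by positivity, ?_⟩
  intro X ι _ _ _ N s r β hN hβ hd hc L ⟨p, hp, hs⟩
  have hK : (0:ℝ) < 7 ^ α := by positivity
  have hpos : ∀ i ∈ L, 0 < p i ∧
      ∑ j ∈ L.erase i, β i * dist (s i) (r i) ^ α * (p j / dist (s j) (r i) ^ α) ≤ p i := by
    intro i hi
    have h := hs i hi
    unfold sinr at h
    have hS : 0 ≤ ∑ j ∈ L.erase i, p j / dist (s j) (r i) ^ α :=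
      sum_nonneg fun j hj => div_nonneg (hp j (mem_of_mem_erase hj)) (by positivity)
    have hD := Real.rpow_pos_of_pos (hd i) α
    have hb := hβ i
    rw [le_div_iff₀ (by positivity), le_div_iff₀ hD] at h
    rw [← mul_sum]
    set S := ∑ j ∈ L.erase i, p j / dist (s j) (r i) ^ α
    have hb0 : 0 < β i := by linarith
    have q : 0 < β i * N * dist (s i) (r i) ^ α := by positivity
    have q2 : 0 ≤ β i * S * dist (s i) (r i) ^ α := by positivity
    constructor <;> nlinarith
  set A : ι → ι → ℝ := fun i j =>
    β i * dist (s i) (r i) ^ α * (p j / dist (s j) (r i) ^ α) with hA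
  have hA0 : ∀ i ∈ L, ∀ j ∈ L, 0 ≤ A i j := by
    intro i hi j hj
    have := hβ i
    have := hp j hj
    simp only [hA]
    positivity
  have hAle : ∀ i ∈ L, ∀ j ∈ L, j ≠ i → A i j ≤ p i := by
    intro i hi j hj hji
    exact (single_le_sum (f := A i) (fun k hk => hA0 i hi k (mem_of_mem_erase hk))
      (mem_erase.2 ⟨hji, hj⟩)).trans (hpos i hi).2
  set M : ι → ι → ℝ := fun i j =>
    min (β i * dist (s i) (r i) ^ α) (β j * dist (s j) (r j) ^ α) /
                  min (dist (s j) (r i) ^ α) (dist (s i) (r j) ^ α) with hM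
  have hM0 : ∀ i j, 0 ≤ M i j := by
    intro i j
    have := hβ i
    have := hβ j
    simp only [hM]
    positivity
  have hMle : ∀ i ∈ L, ∀ j ∈ L.erase i, M i j ≤ 7 ^ α * (A i j / p i + A j i / p j) := by
    intro i hi j hj
    obtain ⟨hji, hj⟩ := mem_erase.1 hj
    exact aux_pair hα (s i) (r i) (s j) (r j) (hβ i) (hβ j) (hpos i hi).1 (hpos j hj).1
      (hd i) (hd j) (hc j i hji) (hc i j hji.symm) (hAle i hi j hj hji) (hAle j hj i hi hji.symm)
  have hrow : ∑ i ∈ L, ∑ j ∈ L.erase i, A i j / p i ≤ L.card := by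
    calc _ ≤ ∑ i ∈ L, (1:ℝ) := by
          refine sum_le_sum fun i hi => ?_
          rw [← sum_div, div_le_one (hpos i hi).1]
          exact (hpos i hi).2
      _ = _ := by simp
  have hswap : ∑ i ∈ L, ∑ j ∈ L.erase i, A j i / p j = ∑ i ∈ L, ∑ j ∈ L.erase i, A i j / p i := by
    refine sum_comm' ?_
    intro x y
    simp only [mem_erase]
    tauto
  have htot : ∑ i ∈ L, ∑ j ∈ L.erase i, M i j ≤ 2 * 7 ^ α * L.card := by
    calc _ ≤ ∑ i ∈ L, ∑ j ∈ L.erase i, 7 ^ α * (A i j / p i + A j i / p j) :=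
          sum_le_sum fun i hi => sum_le_sum fun j hj => hMle i hi j hj
      _ = 7 ^ α * (∑ i ∈ L, ∑ j ∈ L.erase i, A i j / p i
            + ∑ i ∈ L, ∑ j ∈ L.erase i, A j i / p j) := by
          simp only [← mul_sum, sum_add_distrib]
      _ ≤ _ := by rw [hswap]; nlinarith
  refine ⟨L.filter (fun i => ∑ j ∈ L.erase i, M i j ≤ 2 * (2 * 7 ^ α)), filter_subset _ _,
    aux_avg L _ _ (by positivity) (fun i _ => sum_nonneg fun j _ => hM0 i j) htot, ?_⟩
  intro i hi
  refine le_trans ?_ (mem_filter.1 hi).2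
  exact sum_le_sum_of_subset_of_nonneg (erase_subset_erase i (filter_subset _ _))
    fun j _ _ => hM0 i j
end

section
/- There exist constants c₁ ∈ (0,1] and C ≥ 0 depending only on α such that for every finite admissible set of links L there is a subset L' ⊆ L with |L'| ≥ c₁·|L| and, for every link ℓ = (s,r) ∈ R (not only ℓ ∈ L), Σ_{ℓ'=(s',r')∈L', π(ℓ') < π(ℓ)} ( min{1, β(ℓ)·dist(s,r)^α / dist(s',r)^α} + min{1, β(ℓ)·dist(s,r)^α / dist(s,r')^α} ) ≤ C. -/
open Finset

universe u v

/-- Geometric core: the sum at an arbitrary point `x`. -/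
lemma core_bound {X : Type u} {ι : Type v} [MetricSpace X] [DecidableEq ι]
    (α : ℝ) (hα : 1 ≤ α) (T : Finset ι) (y z : ι → X) (e : ι → ℝ) (e0 : ℝ) (x : X)
    (W : ι → ι → ℝ) (B : ℝ) (he0 : 0 < e0) (he : ∀ j ∈ T, e0 ≤ e j)
    (hd : ∀ j ∈ T, dist (y j) (z j) ≤ e j)
    (hpos : ∀ j ∈ T, ∀ k ∈ T, j ≠ k → 0 < dist (y j) (z k))
    (hx : ∀ j ∈ T, 0 < dist (y j) x) (hB : 0 ≤ B)
    (hW0 : ∀ j ∈ T, ∀ k ∈ T, j ≠ k → 0 ≤ W j k)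
    (hW : ∀ j ∈ T, ∀ k ∈ T, j ≠ k →
      (e j * e k / (dist (y j) (z k) * dist (y k) (z j))) ^ α ≤ (W j k) ^ 2)
    (hsum : ∀ k ∈ T, ∑ j ∈ T.erase k, W j k ≤ B) :
    ∑ j ∈ T, min 1 (e0 ^ α / dist (y j) x ^ α) ≤ 1 + 3 ^ α * B := by
  have h3 : (0:ℝ) < 3 ^ α := by positivity
  rcases T.eq_empty_or_nonempty with rfl | hne
  · simp only [Finset.sum_empty]; positivity
  obtain ⟨k, hk, hmin⟩ := T.exists_min_image (fun j => dist (y j) x) hne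
  rw [← Finset.add_sum_erase T _ hk]
  refine add_le_add (min_le_left _ _) ?_
  refine le_trans ?_ (mul_le_mul_of_nonneg_left (hsum k hk) h3.le)
  rw [Finset.mul_sum]
  refine Finset.sum_le_sum fun j hj => ?_
  have hjk : j ≠ k := Finset.ne_of_mem_erase hj
  have hjT : j ∈ T := Finset.mem_of_mem_erase hj
  set d := dist (y j) x with hdd
  have hdp : 0 < d := hx j hjT
  have hD : dist (y j) (y k) ≤ 2 * d := by
    have h1 := dist_triangle (y j) x (y k)
    have h2 := hmin j hjT
    rw [dist_comm x] at h1
    linarith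
  have hQ : dist (y j) (z k) ≤ 2 * d + e k := by
    have := dist_triangle (y j) (y k) (z k); have := hd k hk; linarith
  have hQ' : dist (y k) (z j) ≤ 2 * d + e j := by
    have := dist_triangle (y k) (y j) (z j); have := hd j hjT
    rw [dist_comm (y k) (y j)] at *; linarith
  have hQp := hpos j hjT k hk hjk
  have hQp' := hpos k hk j hjT hjk.symm
  have hej := he j hjT
  have hek := he k hk
  have mono : ∀ t, e0 ≤ t → e0 / (2 * d + e0) ≤ t / (2 * d + t) := by
    intro t ht
    rw [div_le_div_iff₀ (by linarith) (by linarith)]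
    nlinarith
  set g := e0 / (2 * d + e0) with hg
  have hgp : 0 < g := by positivity
  have h1 : g * g ≤ e j * e k / (dist (y j) (z k) * dist (y k) (z j)) := by
    calc g * g ≤ (e j / (2 * d + e j)) * (e k / (2 * d + e k)) :=
          mul_le_mul (mono _ hej) (mono _ hek) hgp.le
            (div_nonneg (by linarith) (by linarith))
      _ = e j * e k / ((2 * d + e k) * (2 * d + e j)) := by
          rw [div_mul_div_comm, mul_comm (2 * d + e j)]
      _ ≤ _ := by
          apply div_le_div_of_nonneg_left
          · exact mul_nonneg (by linarith) (by linarith)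
          · positivity
          · exact mul_le_mul hQ hQ' hQp'.le (by linarith)
  have h2 : g ^ α ≤ W j k := by
    have h := Real.rpow_le_rpow (by positivity) h1 (by linarith : 0 ≤ α)
    rw [Real.mul_rpow hgp.le hgp.le] at h
    have h' := h.trans (hW j hjT k hk hjk)
    rw [← sq] at h'
    exact le_of_sq_le_sq h' (hW0 j hjT k hk hjk)
  refine le_trans ?_ (mul_le_mul_of_nonneg_left h2 h3.le)
  rw [← Real.mul_rpow (by norm_num) hgp.le, ← Real.div_rpow he0.le hdp.le]
  rcases le_total d e0 with hc | hc
  · refine (min_le_left _ _).trans (Real.one_le_rpow ?_ (by linarith))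
    rw [hg, mul_div_assoc', le_div_iff₀ (by positivity)]; linarith
  · refine (min_le_right _ _).trans (Real.rpow_le_rpow (by positivity) ?_ (by linarith))
    rw [hg, mul_div_assoc', div_le_div_iff₀ hdp (by positivity)]; nlinarith

theorem admissible_incoming_outgoing_bound (α : ℝ) (hα : 1 ≤ α) :
    ∃ c₁ C : ℝ, 0 < c₁ ∧ c₁ ≤ 1 ∧ 0 ≤ C ∧
      ∀ (X : Type u) (ι : Type v) [MetricSpace X] [Fintype ι] [DecidableEq ι]
        (N : ℝ) (s r : ι → X) (β : ι → ℝ) (π : ι → ℕ),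
        0 < N →
        (∀ i, 1 ≤ β i) →
        (∀ i, 0 < dist (s i) (r i)) →
        (∀ i j, i ≠ j → 0 < dist (s i) (r j)) →
        Function.Injective π →
        (∀ i j, π i < π j →
          β j * dist (s j) (r j) ^ α ≤ β i * dist (s i) (r i) ^ α) →
        ∀ L : Finset ι, Admissible α N s r β L →
          ∃ L' ⊆ L, c₁ * (L.card : ℝ) ≤ (L'.card : ℝ) ∧
            ∀ i : ι, ∑ j ∈ L'.filter (fun j => π j < π i),
                (min 1 (β i * dist (s i) (r i) ^ α / dist (s j) (r i) ^ α)
                  + min 1 (β i * dist (s i) (r i) ^ α / dist (s i) (r j) ^ α))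
              ≤ C := by
  refine ⟨1 / 2, (1 + 3 ^ α * 3) + (1 + 3 ^ α * 3), by norm_num, by norm_num, by positivity, ?_⟩
  intro X ι _ _ _ N s r β π hN hβ hself hcross hinj hord L hL
  obtain ⟨p, hp0, hp⟩ := hL
  have hα0 : α ≠ 0 := by linarith
  have hI0 : ∀ i ∈ L, 0 ≤ ∑ j ∈ L.erase i, p j / dist (s j) (r i) ^ α := fun i _ =>
    Finset.sum_nonneg fun j hj =>
      div_nonneg (hp0 j (Finset.mem_of_mem_erase hj)) (Real.rpow_nonneg dist_nonneg _)
  have hdα : ∀ i, 0 < dist (s i) (r i) ^ α := fun i => Real.rpow_pos_of_pos (hself i) _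
  have hkey : ∀ i ∈ L, β i * dist (s i) (r i) ^ α *
      ((∑ j ∈ L.erase i, p j / dist (s j) (r i) ^ α) + N) ≤ p i := by
    intro i hi
    have h := hp i hi
    unfold sinr at h
    rw [le_div_iff₀ (by linarith [hI0 i hi]), le_div_iff₀ (hdα i)] at h
    linarith
  have hE : ∀ i, 0 < β i * dist (s i) (r i) ^ α := fun i =>
    mul_pos (by linarith [hβ i]) (hdα i)
  have hpp : ∀ i ∈ L, 0 < p i := fun i hi =>
    lt_of_lt_of_le (mul_pos (hE i) (by linarith [hI0 i hi])) (hkey i hi)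
  -- normalised interference matrix
  let A : ι → ι → ℝ := fun k j =>
    β k * dist (s k) (r k) ^ α * (p j / dist (s j) (r k) ^ α) / p k
  have hA0 : ∀ k ∈ L, ∀ j ∈ L, 0 ≤ A k j := fun k hk j hj =>
    div_nonneg (mul_nonneg (hE k).le (div_nonneg (hp0 j hj) (Real.rpow_nonneg dist_nonneg _)))
      (hp0 k hk)
  have hrow : ∀ k ∈ L, ∑ j ∈ L.erase k, A k j ≤ 1 := by
    intro k hk
    have h := hkey k hk
    have h2 := mul_pos (hE k) hN
    simp only [A]
    rw [← Finset.sum_div, ← Finset.mul_sum, div_le_one (hpp k hk)]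
    linarith
  let col : ι → ℝ := fun j => ∑ k ∈ L.erase j, A k j
  have hcol0 : ∀ j ∈ L, 0 ≤ col j := fun j hj =>
    Finset.sum_nonneg fun k hk => hA0 k (Finset.mem_of_mem_erase hk) j hj
  have htot : ∑ j ∈ L, col j ≤ L.card := by
    have : ∑ j ∈ L, col j = ∑ k ∈ L, ∑ j ∈ L.erase k, A k j := by
      refine Finset.sum_comm' ?_
      intro a b; simp only [Finset.mem_erase]; tauto
    rw [this]
    calc _ ≤ ∑ k ∈ L, (1:ℝ) := Finset.sum_le_sum hrow
      _ = _ := by simp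
  refine ⟨L.filter (fun j => col j ≤ 2), Finset.filter_subset _ _, ?_, ?_⟩
  · have hc := Finset.card_filter_add_card_filter_not (s := L) (fun j => col j ≤ 2)
    have hc' : ((L.filter (fun j => col j ≤ 2)).card : ℝ) +
      (L.filter (fun j => ¬ col j ≤ 2)).card = L.card := by exact_mod_cast hc
    have hbad : 2 * ((L.filter (fun j => ¬ col j ≤ 2)).card : ℝ) ≤ L.card := by
      calc 2 * ((L.filter (fun j => ¬ col j ≤ 2)).card : ℝ)
          = ∑ j ∈ L.filter (fun j => ¬ col j ≤ 2), (2:ℝ) := by simp [mul_comm]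
        _ ≤ ∑ j ∈ L.filter (fun j => ¬ col j ≤ 2), col j :=
            Finset.sum_le_sum fun j hj => (not_le.1 (Finset.mem_filter.1 hj).2).le
        _ ≤ ∑ j ∈ L, col j :=
            Finset.sum_le_sum_of_subset_of_nonneg (Finset.filter_subset _ _)
              fun j hj _ => hcol0 j hj
        _ ≤ _ := htot
    linarith
  intro i
  set T := (L.filter (fun j => col j ≤ 2)).filter (fun j => π j < π i) with hT
  have hTL : ∀ j ∈ T, j ∈ L := fun j hj => by
    simp only [hT, Finset.mem_filter] at hj; exact hj.1.1
  have hTc : ∀ j ∈ T, col j ≤ 2 := fun j hj => by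
    simp only [hT, Finset.mem_filter] at hj; exact hj.1.2
  have hTπ : ∀ j ∈ T, π j < π i := fun j hj => by
    simp only [hT, Finset.mem_filter] at hj; exact hj.2
  have hTi : ∀ j ∈ T, j ≠ i := fun j hj h => by
    have := hTπ j hj; rw [h] at this; exact lt_irrefl _ this
  let e : ι → ℝ := fun j => (β j * dist (s j) (r j) ^ α) ^ α⁻¹
  have heα : ∀ j, e j ^ α = β j * dist (s j) (r j) ^ α := fun j =>
    Real.rpow_inv_rpow (hE j).le hα0
  have hep : ∀ j, 0 < e j := fun j => Real.rpow_pos_of_pos (hE j) _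
  have hde : ∀ j, dist (s j) (r j) ≤ e j := by
    intro j
    have h1 : dist (s j) (r j) ^ α ≤ β j * dist (s j) (r j) ^ α :=
      le_mul_of_one_le_left (hdα j).le (hβ j)
    have h2 := Real.rpow_le_rpow (hdα j).le h1 (by positivity : 0 ≤ α⁻¹)
    rwa [Real.rpow_rpow_inv dist_nonneg hα0] at h2
  have hei : ∀ j ∈ T, e i ≤ e j := fun j hj =>
    Real.rpow_le_rpow (hE i).le (hord j i (hTπ j hj)) (by positivity)
  let W : ι → ι → ℝ := fun j k => A k j + A j k
  have hW0 : ∀ j ∈ T, ∀ k ∈ T, j ≠ k → 0 ≤ W j k := fun j hj k hk _ =>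
    add_nonneg (hA0 k (hTL k hk) j (hTL j hj)) (hA0 j (hTL j hj) k (hTL k hk))
  have hW : ∀ j ∈ T, ∀ k ∈ T, j ≠ k →
      (e j * e k / (dist (s j) (r k) * dist (s k) (r j))) ^ α ≤ (W j k) ^ 2 := by
    intro j hj k hk hjk
    have ha := hA0 k (hTL k hk) j (hTL j hj)
    have hb := hA0 j (hTL j hj) k (hTL k hk)
    have hpj := (hpp j (hTL j hj)).ne'
    have hpk := (hpp k (hTL k hk)).ne'
    have hq1 := (Real.rpow_pos_of_pos (hcross j k hjk) α).ne'
    have hq2 := (Real.rpow_pos_of_pos (hcross k j hjk.symm) α).ne'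
    have heq : (e j * e k / (dist (s j) (r k) * dist (s k) (r j))) ^ α = A k j * A j k := by
      rw [Real.div_rpow (mul_pos (hep j) (hep k)).le (by positivity),
        Real.mul_rpow (hep j).le (hep k).le, Real.mul_rpow dist_nonneg dist_nonneg,
        heα, heα]
      simp only [A]
      field_simp
    rw [heq]
    simp only [W]
    nlinarith [mul_nonneg ha hb, sq_nonneg (A k j), sq_nonneg (A j k)]
  have hsum : ∀ k ∈ T, ∑ j ∈ T.erase k, W j k ≤ 3 := by
    intro k hk
    have hkL := hTL k hk
    have hsub : T.erase k ⊆ L.erase k := Finset.erase_subset_erase _ hTL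
    have h1 : ∑ j ∈ T.erase k, A k j ≤ 1 :=
      (Finset.sum_le_sum_of_subset_of_nonneg hsub fun j hj _ =>
        hA0 k hkL j (Finset.mem_of_mem_erase hj)).trans (hrow k hkL)
    have h2 : ∑ j ∈ T.erase k, A j k ≤ 2 :=
      (Finset.sum_le_sum_of_subset_of_nonneg hsub fun j hj _ =>
        hA0 j (Finset.mem_of_mem_erase hj) k hkL).trans (hTc k hk)
    simp only [W, Finset.sum_add_distrib]
    linarith
  rw [Finset.sum_add_distrib, ← heα i]
  refine add_le_add ?_ ?_
  · exact core_bound α hα T s r e (e i) (r i) W 3 (hep i) hei (fun j _ => hde j)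
      (fun j _ k _ h => hcross j k h) (fun j hj => hcross j i (hTi j hj)) (by norm_num)
      hW0 hW hsum
  · have h := core_bound α hα T r s e (e i) (s i) W 3 (hep i) hei
      (fun j _ => by rw [dist_comm]; exact hde j)
      (fun j _ k _ h => by rw [dist_comm]; exact hcross k j h.symm)
      (fun j hj => by rw [dist_comm]; exact hcross i j (hTi j hj).symm) (by norm_num)
      hW0 (fun j hj k hk hjk => by
        have := hW j hj k hk hjk
        rwa [dist_comm (r j), dist_comm (r k), mul_comm (dist (s k) (r j))]) hsum
    simpa only [dist_comm (s i)] using h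
end

section
/- There exist constants c₁ ∈ (0,1] and C ≥ 0 depending only on α such that for every finite admissible set of links L there is a subset L' ⊆ L with |L'| ≥ c₁·|L| and, for every link ℓ = (s,r) ∈ R (not only ℓ ∈ L), Σ_{ℓ'=(s',r')∈L', π(ℓ') < π(ℓ)} min{1, β(ℓ)·β(ℓ')·(dist(s,r)^α·dist(s',r')^α) / (dist(s,r')^α·dist(s',r)^α)} ≤ C. -/
open Finset

universe u v

/-- Normalised pair weight. -/
noncomputable def qW {X : Type u} {ι : Type v} [MetricSpace X] (s r : ι → X) (D : ι → ℝ)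
    (i j : ι) : ℝ := D i * D j / (dist (s i) (r j) * dist (s j) (r i))

theorem half_subset {ι : Type v} [DecidableEq ι] (L : Finset ι) (a : ι → ι → ℝ)
    (ha : ∀ i ∈ L, ∀ j ∈ L, 0 ≤ a i j)
    (hs : ∀ j ∈ L, ∑ k ∈ L.erase j, a k j ≤ 1) :
    ∃ L' ⊆ L, (1/2 : ℝ) * (L.card : ℝ) ≤ (L'.card : ℝ) ∧
      ∀ k ∈ L', ∑ j ∈ L.erase k, a k j ≤ 2 := by
  refine ⟨L.filter (fun k => ∑ j ∈ L.erase k, a k j ≤ 2), filter_subset _ _, ?_, ?_⟩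
  · have h1 : ∑ k ∈ L, ∑ j ∈ L.erase k, a k j ≤ L.card := by
      have : ∑ k ∈ L, ∑ j ∈ L.erase k, a k j = ∑ j ∈ L, ∑ k ∈ L.erase j, a k j := by
        apply Finset.sum_comm'
        intro x y
        simp only [mem_erase]
        tauto
      rw [this]
      calc _ ≤ ∑ j ∈ L, (1:ℝ) := Finset.sum_le_sum hs
        _ = _ := by simp
    have h2 : ∑ k ∈ L.filter (fun k => ¬ ∑ j ∈ L.erase k, a k j ≤ 2), (2:ℝ)
        ≤ ∑ k ∈ L, ∑ j ∈ L.erase k, a k j := by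
      refine le_trans (Finset.sum_le_sum (g := fun k => ∑ j ∈ L.erase k, a k j) ?_)
        (Finset.sum_le_sum_of_subset_of_nonneg (filter_subset _ _) ?_)
      · intro k hk
        exact (not_le.1 (mem_filter.1 hk).2).le
      · intro k hk _
        exact Finset.sum_nonneg fun j hj => ha k hk j (mem_of_mem_erase hj)
    have h3 := Finset.card_filter_add_card_filter_not (s := L)
      (fun k => ∑ j ∈ L.erase k, a k j ≤ 2)
    have h4 : ((L.filter (fun k => ∑ j ∈ L.erase k, a k j ≤ 2)).card : ℝ) +
      ((L.filter (fun k => ¬ ∑ j ∈ L.erase k, a k j ≤ 2)).card : ℝ) = L.card := by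
      exact_mod_cast h3
    simp only [sum_const, nsmul_eq_mul] at h2
    linarith
  · intro k hk
    exact (mem_filter.1 hk).2

theorem core_bound_s12 {X : Type u} {ι : Type v} [MetricSpace X] [DecidableEq ι]
    (α : ℝ) (hα : 1 ≤ α) (s r : ι → X) (D : ι → ℝ) (M : ℝ) (hM : 0 ≤ M)
    (hd : ∀ i, 0 < dist (s i) (r i)) (hD : ∀ i, dist (s i) (r i) ≤ D i)
    (hp : ∀ i j, 0 < dist (s i) (r j)) (T : Finset ι) (i : ι)
    (hT : ∀ j ∈ T, D i ≤ D j)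
    (hs : ∀ k ∈ T, ∑ j ∈ T.erase k, qW s r D k j ^ α ≤ M) :
    ∑ j ∈ T, min 1 (qW s r D i j ^ α) ≤ 3 * (1 + 9 ^ α * M) := by
  have hα0 : 0 ≤ α := by linarith
  have hDp : ∀ i, 0 < D i := fun i => (hd i).trans_le (hD i)
  have hq : ∀ i j, 0 < qW s r D i j := fun i j =>
    div_pos (mul_pos (hDp i) (hDp j)) (mul_pos (hp i j) (hp j i))
  have h9 : (0:ℝ) < 9 ^ α := Real.rpow_pos_of_pos (by norm_num) α
  -- comparison
  have cmp : ∀ j k, dist (s k) (r j) * dist (s j) (r k) * D i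
      ≤ 9 * D k * (dist (s i) (r j) * dist (s j) (r i)) →
      qW s r D i j ^ α ≤ 9 ^ α * qW s r D k j ^ α := by
    intro j k h
    rw [← Real.mul_rpow (by norm_num) (hq k j).le]
    apply Real.rpow_le_rpow (hq i j).le _ hα0
    unfold qW
    rw [← mul_div_assoc, div_le_div_iff₀ (mul_pos (hp i j) (hp j i)) (mul_pos (hp k j) (hp j k))]
    nlinarith [mul_le_mul_of_nonneg_left h (hDp j).le]
  have cardb : ∀ S ⊆ T, (∀ j ∈ S, ∀ k ∈ S,
      dist (s j) (r k) * dist (s k) (r j) ≤ 9 * (D j * D k)) →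
      (S.card : ℝ) ≤ 1 + 9 ^ α * M := by
    intro S hST h
    rcases S.eq_empty_or_nonempty with rfl | ⟨k, hk⟩
    · simp; positivity
    · have h1 : ∑ j ∈ S.erase k, (1:ℝ) ≤ ∑ j ∈ S.erase k, 9 ^ α * qW s r D k j ^ α := by
        apply Finset.sum_le_sum
        intro j hj
        rw [← Real.mul_rpow (by norm_num) (hq k j).le]
        apply Real.one_le_rpow _ hα0
        unfold qW
        rw [← mul_div_assoc, one_le_div (mul_pos (hp k j) (hp j k))]
        exact h k hk j (mem_of_mem_erase hj)
      rw [← Finset.mul_sum] at h1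
      have h2 : ∑ j ∈ S.erase k, qW s r D k j ^ α ≤ M :=
        (Finset.sum_le_sum_of_subset_of_nonneg (Finset.erase_subset_erase k hST)
          (fun j _ _ => (Real.rpow_pos_of_pos (hq k j) α).le)).trans (hs k (hST hk))
      have h3 := mul_le_mul_of_nonneg_left h2 h9.le
      have h4 : ((S.erase k).card : ℝ) + 1 = S.card := by
        exact_mod_cast Finset.card_erase_add_one hk
      simp only [sum_const, nsmul_eq_mul, mul_one] at h1
      linarith
  -- the three pieces
  have tri : ∀ a b c d : X, dist a d ≤ dist a b + dist c b + dist c d := by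
    intro a b c d
    have := dist_triangle4 a b c d
    rwa [dist_comm b c] at this
  set S1 := T.filter (fun j => dist (s i) (r j) ≤ D i) with hS1
  set S2 := (T.filter (fun j => ¬ dist (s i) (r j) ≤ D i)).filter
    (fun j => dist (s j) (r i) ≤ D i) with hS2
  set S3 := (T.filter (fun j => ¬ dist (s i) (r j) ≤ D i)).filter
    (fun j => ¬ dist (s j) (r i) ≤ D i) with hS3
  have split : ∑ j ∈ T, min 1 (qW s r D i j ^ α) = ∑ j ∈ S1, min 1 (qW s r D i j ^ α) +
      (∑ j ∈ S2, min 1 (qW s r D i j ^ α) + ∑ j ∈ S3, min 1 (qW s r D i j ^ α)) := by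
    rw [hS1, hS2, hS3, Finset.sum_filter_add_sum_filter_not, Finset.sum_filter_add_sum_filter_not]
  have sumcard : ∀ S : Finset ι, ∑ j ∈ S, min 1 (qW s r D i j ^ α) ≤ S.card := by
    intro S
    calc _ ≤ ∑ j ∈ S, (1:ℝ) := Finset.sum_le_sum fun j _ => min_le_left _ _
      _ = _ := by simp
  have sub3 : S3 ⊆ T := (filter_subset _ _).trans (filter_subset _ _)
  have b1 : (S1.card : ℝ) ≤ 1 + 9 ^ α * M := by
    apply cardb S1 (filter_subset _ _)
    intro j hj k hk
    obtain ⟨hjT, hj⟩ := mem_filter.1 hj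
    obtain ⟨hkT, hk⟩ := mem_filter.1 hk
    have e1 : dist (s j) (r k) ≤ 3 * D j := by
      have := tri (s j) (r j) (s i) (r k)
      linarith [hT j hjT, hD j]
    have e2 : dist (s k) (r j) ≤ 3 * D k := by
      have := tri (s k) (r k) (s i) (r j)
      linarith [hT k hkT, hD k]
    nlinarith [mul_le_mul e1 e2 (hp k j).le (by linarith [hDp j])]
  have b2 : (S2.card : ℝ) ≤ 1 + 9 ^ α * M := by
    apply cardb S2 ((filter_subset _ _).trans (filter_subset _ _))
    intro j hj k hk
    obtain ⟨hjT, hj⟩ := mem_filter.1 hj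
    obtain ⟨hkT, hk⟩ := mem_filter.1 hk
    have hjT := (mem_filter.1 hjT).1
    have hkT := (mem_filter.1 hkT).1
    have e1 : dist (s j) (r k) ≤ 3 * D k := by
      have := tri (s j) (r i) (s k) (r k)
      linarith [hT k hkT, hD k]
    have e2 : dist (s k) (r j) ≤ 3 * D j := by
      have := tri (s k) (r i) (s j) (r j)
      linarith [hT j hjT, hD j]
    nlinarith [mul_le_mul e1 e2 (hp k j).le (by linarith [hDp k])]
  have b3 : ∑ j ∈ S3, min 1 (qW s r D i j ^ α) ≤ 1 + 9 ^ α * M := by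
    rcases S3.eq_empty_or_nonempty with h0 | hne
    · rw [h0]; simp; positivity
    · obtain ⟨k, hk, hmin⟩ := Finset.exists_min_image S3
        (fun j => min (dist (s i) (r j)) (dist (s j) (r i))) hne
      have key : ∀ j ∈ S3, qW s r D i j ^ α ≤ 9 ^ α * qW s r D k j ^ α := by
        intro j hj
        apply cmp
        have hm := hmin j hj
        have hkT := hT k (sub3 hk)
        obtain ⟨hj1, hjB⟩ := mem_filter.1 hj
        have hjA := (mem_filter.1 hj1).2
        push Not at hjA hjB
        have hdi := hD i
        have hdk := hD k
        have hDi := hDp i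
        have hDk := hDp k
        have big : ∀ x y : ℝ, D i ≤ x → y ≤ 2 * x + D k → y * D i ≤ 3 * D k * x := by
          intro x y hx hy
          nlinarith [mul_le_mul_of_nonneg_right hy hDi.le, mul_le_mul_of_nonneg_right hx hDk.le,
            mul_le_mul_of_nonneg_right hkT (hDi.le.trans hx)]
        rcases le_total (dist (s i) (r k)) (dist (s k) (r i)) with hc | hc
        · rw [min_eq_left hc] at hm
          obtain ⟨m1, m2⟩ := le_min_iff.1 hm
          have e1 : dist (s k) (r j) * D i ≤ 3 * D k * dist (s i) (r j) := by
            apply big _ _ hjA.le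
            linarith [tri (s k) (r k) (s i) (r j)]
          have e2 : dist (s j) (r k) ≤ 3 * dist (s j) (r i) := by
            linarith [tri (s j) (r i) (s i) (r k)]
          have := mul_le_mul e1 e2 (hp j k).le
            (mul_nonneg (by linarith) (hp i j).le)
          nlinarith
        · rw [min_eq_right hc] at hm
          obtain ⟨m1, m2⟩ := le_min_iff.1 hm
          have e1 : dist (s j) (r k) * D i ≤ 3 * D k * dist (s j) (r i) := by
            apply big _ _ hjB.le
            linarith [tri (s j) (r i) (s k) (r k)]
          have e2 : dist (s k) (r j) ≤ 3 * dist (s i) (r j) := by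
            linarith [tri (s k) (r i) (s i) (r j)]
          have := mul_le_mul e1 e2 (hp k j).le
            (mul_nonneg (by linarith) (hp j i).le)
          nlinarith
      rw [← Finset.add_sum_erase S3 _ hk]
      have h1 : ∑ j ∈ S3.erase k, min 1 (qW s r D i j ^ α)
          ≤ ∑ j ∈ S3.erase k, 9 ^ α * qW s r D k j ^ α :=
        Finset.sum_le_sum fun j hj => (min_le_right _ _).trans (key j (mem_of_mem_erase hj))
      rw [← Finset.mul_sum] at h1
      have h2 : ∑ j ∈ S3.erase k, qW s r D k j ^ α ≤ M :=
        (Finset.sum_le_sum_of_subset_of_nonneg (Finset.erase_subset_erase k sub3)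
          (fun j _ _ => (Real.rpow_pos_of_pos (hq k j) α).le)).trans (hs k (sub3 hk))
      have h3 := mul_le_mul_of_nonneg_left h2 h9.le
      have h4 : min 1 (qW s r D i k ^ α) ≤ 1 := min_le_left _ _
      linarith
  linarith [sumcard S1, sumcard S2]

/-- Claim: there are constants `c₁ ∈ (0,1]`, `C ≥ 0` depending only on `α` such
that every admissible set `L` has a subset `L'` with `|L'| ≥ c₁·|L|` and, for every
link `ℓ` of the ground set,
`Σ_{ℓ'∈L', π(ℓ')<π(ℓ)} min{1, β(ℓ)β(ℓ')·(d(s,r)^α d(s',r')^α)/(d(s,r')^α d(s',r)^α)} ≤ C`. -/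
theorem admissible_product_weight_bound (α : ℝ) (hα : 1 ≤ α) :
    ∃ c₁ C : ℝ, 0 < c₁ ∧ c₁ ≤ 1 ∧ 0 ≤ C ∧
      ∀ (X : Type u) (ι : Type v) [MetricSpace X] [Fintype ι] [DecidableEq ι]
        (N : ℝ) (s r : ι → X) (β : ι → ℝ) (π : ι → ℕ),
        0 < N →
        (∀ i, 1 ≤ β i) →
        (∀ i, 0 < dist (s i) (r i)) →
        (∀ i j, i ≠ j → 0 < dist (s i) (r j)) →
        Function.Injective π →
        (∀ i j, π i < π j →
          β j * dist (s j) (r j) ^ α ≤ β i * dist (s i) (r i) ^ α) →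
        ∀ L : Finset ι, Admissible α N s r β L →
          ∃ L' ⊆ L, c₁ * (L.card : ℝ) ≤ (L'.card : ℝ) ∧
            ∀ i : ι, ∑ j ∈ L'.filter (fun j => π j < π i),
                min 1 (β i * β j * (dist (s i) (r i) ^ α * dist (s j) (r j) ^ α) /
                  (dist (s i) (r j) ^ α * dist (s j) (r i) ^ α))
              ≤ C := by
  have hα0 : 0 < α := by linarith
  have h9 : (0:ℝ) < 9 ^ α := Real.rpow_pos_of_pos (by norm_num) α
  refine ⟨1/2, 3 * (1 + 9 ^ α * 2), by norm_num, by norm_num, by positivity, ?_⟩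
  intro X ι _ _ _ N s r β π hN hβ hd hne hπ hord L hL
  have hp : ∀ i j, 0 < dist (s i) (r j) := by
    intro i j
    by_cases h : i = j
    · subst h; exact hd i
    · exact hne i j h
  have hpα : ∀ i j, 0 < dist (s i) (r j) ^ α := fun i j => Real.rpow_pos_of_pos (hp i j) α
  have hβp : ∀ i, 0 < β i := fun i => lt_of_lt_of_le one_pos (hβ i)
  obtain ⟨p, hp0, hsinr⟩ := hL
  have hden : ∀ i, 0 < (∑ j ∈ L.erase i, p j / dist (s j) (r i) ^ α) + N := by
    intro i
    have : 0 ≤ ∑ j ∈ L.erase i, p j / dist (s j) (r i) ^ α :=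
      Finset.sum_nonneg fun j hj => div_nonneg (hp0 j (mem_of_mem_erase hj)) (hpα j i).le
    linarith
  have hpp : ∀ i ∈ L, 0 < p i := by
    intro i hi
    rcases (hp0 i hi).lt_or_eq with h | h
    · exact h
    · have := hsinr i hi
      simp only [sinr, ← h, zero_div] at this
      linarith [hβp i]
  set a : ι → ι → ℝ := fun k j =>
    β j * (p k / dist (s k) (r j) ^ α) / (p j / dist (s j) (r j) ^ α) with ha
  have ha0 : ∀ i ∈ L, ∀ j ∈ L, 0 ≤ a i j := by
    intro i hi j hj
    have := hpp i hi
    have := hpp j hj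
    have := hpα i j
    have := hpα j j
    have := hβp j
    simp only [ha]
    positivity
  have hsum : ∀ j ∈ L, ∑ k ∈ L.erase j, a k j ≤ 1 := by
    intro j hj
    simp only [ha]
    rw [← Finset.sum_div, ← Finset.mul_sum, div_le_one (div_pos (hpp j hj) (hpα j j))]
    have := hsinr j hj
    unfold sinr at this
    rw [le_div_iff₀ (hden j)] at this
    nlinarith [mul_pos (hβp j) hN]
  obtain ⟨L', hL', hcard, hout⟩ := half_subset L a ha0 hsum
  refine ⟨L', hL', hcard, ?_⟩
  intro i
  set D : ι → ℝ := fun i => β i ^ (1/α) * dist (s i) (r i) with hDdef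
  have hDpow : ∀ i, D i ^ α = β i * dist (s i) (r i) ^ α := by
    intro i
    simp only [hDdef]
    rw [Real.mul_rpow (Real.rpow_nonneg (hβp i).le _) (hd i).le, ← Real.rpow_mul (hβp i).le,
      one_div_mul_cancel hα0.ne', Real.rpow_one]
  have hD : ∀ i, dist (s i) (r i) ≤ D i := by
    intro i
    exact le_mul_of_one_le_left (hd i).le (Real.one_le_rpow (hβ i) (by positivity))
  have hDp : ∀ i, 0 < D i := fun i => (hd i).trans_le (hD i)
  have hqW : ∀ i j, qW s r D i j ^ α =
      β i * β j * (dist (s i) (r i) ^ α * dist (s j) (r j) ^ α) /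
                  (dist (s i) (r j) ^ α * dist (s j) (r i) ^ α) := by
    intro i j
    unfold qW
    rw [Real.div_rpow (mul_pos (hDp i) (hDp j)).le (mul_pos (hp i j) (hp j i)).le,
      Real.mul_rpow (hDp i).le (hDp j).le, Real.mul_rpow (hp i j).le (hp j i).le, hDpow, hDpow]
    congr 1
    ring
  simp only [← hqW]
  have hsubL : L'.filter (fun j => π j < π i) ⊆ L := (filter_subset _ _).trans hL'
  apply core_bound_s12 α hα s r D 2 (by norm_num) hd hD hp
  · intro j hj
    have := hord j i (mem_filter.1 hj).2
    rw [← hDpow, ← hDpow] at this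
    exact (Real.rpow_le_rpow_iff (hDp i).le (hDp j).le hα0).1 this
  · intro k hk
    have hkL := hsubL hk
    refine le_trans ?_ (hout k (mem_filter.1 hk).1)
    refine le_trans (Finset.sum_le_sum (g := fun j => a k j) ?_)
      (Finset.sum_le_sum_of_subset_of_nonneg (Finset.erase_subset_erase k hsubL) ?_)
    · intro j hj
      obtain ⟨hjk, hj⟩ := mem_erase.1 hj
      have hjL := hsubL hj
      have e : qW s r D k j ^ α = a k j * a j k := by
        rw [hqW]
        simp only [ha]
        have := (hpp k hkL).ne'
        have := (hpp j hjL).ne'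
        have := (hpα k j).ne'
        have := (hpα j k).ne'
        have := (hpα k k).ne'
        have := (hpα j j).ne'
        field_simp
      rw [e]
      apply mul_le_of_le_one_right (ha0 k hkL j hjL)
      refine le_trans ?_ (hsum k hkL)
      exact Finset.single_le_sum (f := fun x => a x k)
        (fun x hx => ha0 x (mem_of_mem_erase hx) k hkL) (mem_erase.2 ⟨hjk, hjL⟩)
    · intro j hj _
      exact ha0 k hkL j (mem_of_mem_erase hj)
end

section
/- There exists a constant C ≥ 0 depending only on α such that the following holds. Let p : R → ℝ≥0 be a power assignment satisfying, for all ℓ, ℓ' ∈ R with π(ℓ) < π(ℓ'): p(ℓ') ≤ p(ℓ) and (1/β(ℓ))·p(ℓ)/d(ℓ)^α ≤ (1/β(ℓ'))·p(ℓ')/d(ℓ')^α, and p(ℓ)/d(ℓ)^α > β(ℓ)·N for all ℓ ∈ R. Then for every finite set L ⊆ R that is feasible under p there is a subset L' ⊆ L with |L'| ≥ |L|/2 such that for every ℓ ∈ R: Σ_{ℓ'∈L', π(ℓ') < π(ℓ)} ( a_p(ℓ,ℓ') + a_p(ℓ',ℓ) ) ≤ C. -/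
open Finset

universe u v

/-- `L` is feasible under the power assignment `p` if every link of `L` has
SINR at least its threshold `β`. -/
def Feasible {X : Type u} {ι : Type v} [MetricSpace X] [DecidableEq ι]
    (α N : ℝ) (s r : ι → X) (β : ι → ℝ) (p : ι → ℝ) (L : Finset ι) : Prop :=
  ∀ i ∈ L, β i ≤ sinr α N s r p L i

/-- The affectance `a_p(ℓ_i, ℓ_j)` of link `ℓ_i` on link `ℓ_j` under the power
assignment `p`. -/
noncomputable def affectance {X : Type u} {ι : Type v} [MetricSpace X]
    (α N : ℝ) (s r : ι → X) (β : ι → ℝ) (p : ι → ℝ) (i j : ι) : ℝ :=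
  min 1 (β j * (p i / dist (s i) (r j) ^ α) /
    (p j / dist (s j) (r j) ^ α - β j * N))

/-- Sum bound when every term is dominated by the effect of one fixed element. -/
lemma sum_le_of_center {ι : Type v} [DecidableEq ι] (S M : Finset ι) (hS : S ⊆ M) (a : ι → ℝ)
    (F : ι → ι → ℝ) (T : ℝ) (hT : 0 ≤ T) (hF : ∀ k j, 0 ≤ F k j)
    (hsum : ∀ k ∈ M, ∑ j ∈ M.erase k, F k j ≤ 2) (ha : ∀ j, a j ≤ 1)
    (h : S.Nonempty → ∃ k ∈ S, ∀ j ∈ S, j ≠ k → a j ≤ T * F k j) :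
    ∑ j ∈ S, a j ≤ 1 + 2 * T := by
  rcases S.eq_empty_or_nonempty with rfl | hne
  · simp; positivity
  obtain ⟨k, hk, hj⟩ := h hne
  rw [← Finset.add_sum_erase _ _ hk]
  have h1 : ∑ j ∈ S.erase k, a j ≤ ∑ j ∈ S.erase k, T * F k j :=
    Finset.sum_le_sum fun j hjS =>
      hj j (Finset.mem_of_mem_erase hjS) (Finset.ne_of_mem_erase hjS)
  have h2 : ∑ j ∈ S.erase k, F k j ≤ ∑ j ∈ M.erase k, F k j :=
    Finset.sum_le_sum_of_subset_of_nonneg (Finset.erase_subset_erase _ hS)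
      fun j _ _ => hF k j
  rw [← Finset.mul_sum] at h1
  have h3 := mul_le_mul_of_nonneg_left (h2.trans (hsum k (hS hk))) hT
  linarith [ha k]

/-- The metric core, used once for senders and once for receivers. -/
lemma core_bound_s13 {ι : Type v} [DecidableEq ι] (M : Finset ι) (a x y d : ι → ℝ) (π : ι → ℕ)
    (E F : ι → ι → ℝ) (T : ℝ) (hT : 0 ≤ T) (hF : ∀ k j, 0 ≤ F k j)
    (hπ : Function.Injective π)
    (hsum : ∀ k ∈ M, ∑ j ∈ M.erase k, F k j ≤ 2) (ha : ∀ j, a j ≤ 1)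
    (hE : ∀ k j, E k j ≤ y k + x j) (hy : ∀ j, y j ≤ x j + d j)
    (h1 : ∀ k ∈ M, ∀ j ∈ M, j ≠ k → E k j ≤ 3 * x j → a j ≤ T * F k j)
    (h2 : ∀ k ∈ M, ∀ j ∈ M, π j < π k → E k j ≤ 3 * d k → 1 ≤ T * F k j) :
    ∑ j ∈ M, a j ≤ 3 + 6 * T := by
  classical
  set G := M.filter (fun j => d j < x j) with hG
  set B := M.filter (fun j => ¬ d j < x j) with hB
  have hGB : ∑ j ∈ M, a j = ∑ j ∈ G, a j + ∑ j ∈ B, a j :=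
    (Finset.sum_filter_add_sum_filter_not M _ a).symm
  have hGs : ∑ j ∈ G, a j ≤ 1 + 2 * T := by
    refine sum_le_of_center G M (Finset.filter_subset _ _) a F T hT hF hsum ha ?_
    intro hne
    obtain ⟨k, hk, hmin⟩ := Finset.exists_min_image G y hne
    refine ⟨k, hk, fun j hj hjk => h1 k (Finset.mem_filter.1 hk).1 j
      (Finset.mem_filter.1 hj).1 hjk ?_⟩
    have := (Finset.mem_filter.1 hj).2
    linarith [hE k j, hmin j hj, hy j]
  have hBs : ∑ j ∈ B, a j ≤ 2 + 4 * T := by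
    rcases B.eq_empty_or_nonempty with h | hne
    · rw [h]; simp; positivity
    obtain ⟨k, hk, hmin⟩ := Finset.exists_min_image B d hne
    have hkx := (Finset.mem_filter.1 hk).2
    rw [← Finset.sum_filter_add_sum_filter_not B (fun j => x j < d k) a]
    have e1 : ∑ j ∈ B.filter (fun j => x j < d k), a j ≤ 1 + 2 * T := by
      refine sum_le_of_center _ M ((Finset.filter_subset _ _).trans (Finset.filter_subset _ _))
        a F T hT hF hsum ha ?_
      intro hne'
      obtain ⟨m, hm, hmax⟩ := Finset.exists_max_image _ π hne'
      obtain ⟨hmB, hmx⟩ := Finset.mem_filter.1 hm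
      refine ⟨m, hm, fun j hj hjm => (ha j).trans ?_⟩
      obtain ⟨hjB, hjx⟩ := Finset.mem_filter.1 hj
      refine h2 m (Finset.mem_filter.1 hmB).1 j (Finset.mem_filter.1 hjB).1
        (lt_of_le_of_ne (hmax j hj) fun h => hjm (hπ h)) ?_
      linarith [hE m j, hy m, hmin m hmB]
    have e2 : ∑ j ∈ B.filter (fun j => ¬ x j < d k), a j ≤ 1 + 2 * T := by
      by_cases hkk : k ∈ B.filter (fun j => ¬ x j < d k)
      · refine sum_le_of_center _ M ((Finset.filter_subset _ _).trans (Finset.filter_subset _ _))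
          a F T hT hF hsum ha ?_
        intro _
        refine ⟨k, hkk, fun j hj hjk => h1 k (Finset.mem_filter.1 hk).1 j
          (Finset.mem_filter.1 (Finset.mem_filter.1 hj).1).1 hjk ?_⟩
        have := (Finset.mem_filter.1 hj).2
        linarith [hE k j, hy k]
      · have h3 : ∑ j ∈ B.filter (fun j => ¬ x j < d k), a j
            ≤ ∑ j ∈ B.filter (fun j => ¬ x j < d k), T * F k j := by
          refine Finset.sum_le_sum fun j hj => h1 k (Finset.mem_filter.1 hk).1 j
            (Finset.mem_filter.1 (Finset.mem_filter.1 hj).1).1 (fun h => hkk (h ▸ hj)) ?_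
          have := (Finset.mem_filter.1 hj).2
          linarith [hE k j, hy k]
        have h4 : ∑ j ∈ B.filter (fun j => ¬ x j < d k), F k j ≤ ∑ j ∈ M.erase k, F k j := by
          refine Finset.sum_le_sum_of_subset_of_nonneg ?_ fun j _ _ => hF k j
          intro j hj
          exact Finset.mem_erase.2 ⟨fun h => hkk (h ▸ hj),
            (Finset.mem_filter.1 (Finset.mem_filter.1 hj).1).1⟩
        rw [← Finset.mul_sum] at h3
        have h5 := mul_le_mul_of_nonneg_left (h4.trans (hsum k (Finset.mem_filter.1 hk).1)) hT
        linarith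
    linarith
  linarith

/-- Half of the elements have out-sum at most `2`. -/
lemma half_out {ι : Type v} [DecidableEq ι] (L : Finset ι) (F : ι → ι → ℝ)
    (hF : ∀ k j, 0 ≤ F k j) (hin : ∀ j ∈ L, ∑ i ∈ L.erase j, F i j ≤ 1) :
    (L.card : ℝ) / 2 ≤ ((L.filter fun i => ∑ j ∈ L.erase i, F i j ≤ 2).card : ℝ) := by
  classical
  have hswap : ∑ i ∈ L, ∑ j ∈ L.erase i, F i j = ∑ j ∈ L, ∑ i ∈ L.erase j, F i j := by
    apply Finset.sum_comm'
    intro i j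
    simp only [Finset.mem_erase]
    constructor
    · rintro ⟨a, b, c⟩; exact ⟨⟨fun h => b h.symm, a⟩, c⟩
    · rintro ⟨⟨a, b⟩, c⟩; exact ⟨b, fun h => a h.symm, c⟩
  have htot : ∑ i ∈ L, ∑ j ∈ L.erase i, F i j ≤ L.card := by
    rw [hswap]
    simpa using Finset.sum_le_sum hin
  have hsplit := Finset.sum_filter_add_sum_filter_not L
    (fun i => ∑ j ∈ L.erase i, F i j ≤ 2) (fun i => ∑ j ∈ L.erase i, F i j)
  have hcard := Finset.card_filter_add_card_filter_not
    (s := L) (fun i => ∑ j ∈ L.erase i, F i j ≤ 2)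
  have hbad : ((L.filter fun i => ¬ ∑ j ∈ L.erase i, F i j ≤ 2).card : ℝ) * 2 ≤
      ∑ i ∈ L.filter (fun i => ¬ ∑ j ∈ L.erase i, F i j ≤ 2), ∑ j ∈ L.erase i, F i j := by
    rw [← nsmul_eq_mul]
    exact Finset.card_nsmul_le_sum _ _ _ fun i hi => (not_le.1 (Finset.mem_filter.1 hi).2).le
  have hgood : 0 ≤ ∑ i ∈ L.filter (fun i => ∑ j ∈ L.erase i, F i j ≤ 2),
      ∑ j ∈ L.erase i, F i j :=
    Finset.sum_nonneg fun i _ => Finset.sum_nonneg fun j _ => hF i j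
  have hc : ((L.filter fun i => ∑ j ∈ L.erase i, F i j ≤ 2).card : ℝ) +
    ((L.filter fun i => ¬ ∑ j ∈ L.erase i, F i j ≤ 2).card : ℝ) = L.card := by
    exact_mod_cast hcard
  linarith

/-- Monotonicity of the ratio under a tripling of the distance. -/
lemma ratio_le {α P P' D D' Q Q' : ℝ} (hα : 0 ≤ α) (hP : 0 ≤ P) (hPP : P ≤ P') (hD : 0 < D)
    (hD' : 0 < D') (hDD : D' ≤ 3 * D) (hQ' : 0 < Q') (hQQ : Q' ≤ Q) :
    (P / D ^ α) / Q ≤ 3 ^ α * ((P' / D' ^ α) / Q') := by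
  have h3 : D' ^ α ≤ 3 ^ α * D ^ α := by
    rw [← Real.mul_rpow (by norm_num) hD.le]
    exact Real.rpow_le_rpow hD'.le hDD hα
  have hDp : 0 < D ^ α := Real.rpow_pos_of_pos hD α
  have hDp' : 0 < D' ^ α := Real.rpow_pos_of_pos hD' α
  have e : (3:ℝ) ^ α * ((P' / D' ^ α) / Q') = (3 ^ α * (P' / D' ^ α)) / Q' := by ring
  rw [e]
  have h4 : P / D ^ α ≤ 3 ^ α * (P' / D' ^ α) := by
    rw [← mul_div_assoc, div_le_div_iff₀ hDp hDp']
    have hP' := hP.trans hPP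
    calc P * D' ^ α ≤ P' * (3 ^ α * D ^ α) := mul_le_mul hPP h3 hDp'.le hP'
      _ = 3 ^ α * P' * D ^ α := by ring
  have h0 : 0 ≤ P / D ^ α := by positivity
  exact div_le_div₀ (h0.trans h4) h4 hQ' hQQ

/-- Characterization of feasible sets under a monotone sublinear power assignment:
there is a constant `C ≥ 0` depending only on `α` such that every set `L` feasible
under `p` has a subset `L'` with `|L'| ≥ |L|/2` and, for every link `ℓ` of the
ground set, `Σ_{ℓ'∈L', π(ℓ')<π(ℓ)} (a_p(ℓ,ℓ') + a_p(ℓ',ℓ)) ≤ C`. -/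
theorem feasible_set_characterization (α : ℝ) (hα : 1 ≤ α) :
    ∃ C : ℝ, 0 ≤ C ∧
      ∀ (X : Type u) (ι : Type v) [MetricSpace X] [Fintype ι] [DecidableEq ι]
        (N : ℝ) (s r : ι → X) (β : ι → ℝ) (π : ι → ℕ) (p : ι → ℝ),
        0 < N →
        (∀ i, 1 ≤ β i) →
        (∀ i, 0 < dist (s i) (r i)) →
        (∀ i j, i ≠ j → 0 < dist (s i) (r j)) →
        Function.Injective π →
        (∀ i j, π i < π j →
          β j * dist (s j) (r j) ^ α ≤ β i * dist (s i) (r i) ^ α) →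
        (∀ i, 0 ≤ p i) →
        (∀ i j, π i < π j → p j ≤ p i) →
        (∀ i j, π i < π j →
          (1 / β i) * (p i / dist (s i) (r i) ^ α)
            ≤ (1 / β j) * (p j / dist (s j) (r j) ^ α)) →
        (∀ i, β i * N < p i / dist (s i) (r i) ^ α) →
        ∀ L : Finset ι, Feasible α N s r β p L →
          ∃ L' ⊆ L, (L.card : ℝ) / 2 ≤ (L'.card : ℝ) ∧
            ∀ i : ι, ∑ j ∈ L'.filter (fun j => π j < π i),
                (affectance α N s r β p i j + affectance α N s r β p j i) ≤ C := by
  refine ⟨6 + 12 * 3 ^ α, by positivity, ?_⟩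
  intro X ι _ _ _ N s r β π p hN hβ hd hD hπ _ hp hpm hqm hsn L hL
  have hα0 : 0 ≤ α := by linarith
  have hβ0 : ∀ i, 0 < β i := fun i => lt_of_lt_of_le one_pos (hβ i)
  set q : ι → ℝ := fun i => (1 / β i) * (p i / dist (s i) (r i) ^ α) with hq
  have hqN : ∀ i, 0 < q i - N := by
    intro i
    have h := hsn i
    have : N < q i := by
      simp only [hq]
      rw [one_div, inv_mul_eq_div, lt_div_iff₀ (hβ0 i)]
      linarith
    linarith
  set F : ι → ι → ℝ := fun k j => (p k / dist (s k) (r j) ^ α) / (q j - N) with hFdef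
  have hF : ∀ k j, 0 ≤ F k j := fun k j =>
    div_nonneg (div_nonneg (hp k) (Real.rpow_nonneg dist_nonneg _)) (hqN j).le
  have hden : ∀ j, p j / dist (s j) (r j) ^ α - β j * N = β j * (q j - N) := by
    intro j
    have := (hβ0 j).ne'
    simp only [hq]
    field_simp
  have haff : ∀ k j, affectance α N s r β p k j = min 1 (F k j) := by
    intro k j
    unfold affectance
    rw [hden, mul_div_mul_left _ _ (hβ0 j).ne']
  have hin : ∀ j ∈ L, ∑ i ∈ L.erase j, F i j ≤ 1 := by
    intro j hj
    have h := hL j hj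
    unfold sinr at h
    have hS : 0 ≤ ∑ i ∈ L.erase j, p i / dist (s i) (r j) ^ α :=
      Finset.sum_nonneg fun i _ => div_nonneg (hp i) (Real.rpow_nonneg dist_nonneg _)
    rw [le_div_iff₀ (by linarith)] at h
    simp only [hFdef]
    rw [← Finset.sum_div, div_le_one (hqN j)]
    have h2 := hden j
    refine le_of_mul_le_mul_left ?_ (hβ0 j)
    rw [← h2]
    linarith
  -- the signal of a link dominates its own normalised strength
  have hself : ∀ k j, q j ≤ q k → ∀ P, p k ≤ P → ∀ D, 0 < D → D ≤ 3 * dist (s k) (r k) →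
      1 ≤ 3 ^ α * ((P / D ^ α) / (q j - N)) := by
    intro k j hqq P hP D hD0 hD3
    have h1 := ratio_le hα0 (hp k) hP (hd k) hD0 hD3 (hqN j) le_rfl
    refine le_trans ?_ h1
    rw [one_le_div (hqN j)]
    have hx : q k ≤ p k / dist (s k) (r k) ^ α := by
      simp only [hq]
      rw [one_div, inv_mul_eq_div]
      exact div_le_self (div_nonneg (hp k) (Real.rpow_nonneg dist_nonneg _)) (hβ k)
    linarith
  refine ⟨L.filter fun i => ∑ j ∈ L.erase i, F i j ≤ 2, Finset.filter_subset _ _,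
    half_out L F hF hin, ?_⟩
  intro i
  set L' := L.filter fun i => ∑ j ∈ L.erase i, F i j ≤ 2 with hL'
  set M := L'.filter (fun j => π j < π i) with hM
  have hML : M ⊆ L := (Finset.filter_subset _ _).trans (Finset.filter_subset _ _)
  have hMi : ∀ j ∈ M, π j < π i := fun j hj => (Finset.mem_filter.1 hj).2
  have hMne : ∀ j ∈ M, j ≠ i := fun j hj h => by
    have := hMi j hj
    rw [h] at this
    exact lt_irrefl _ this
  have hT : (0:ℝ) ≤ 3 ^ α := by positivity
  rw [Finset.sum_add_distrib]
  have part1 : ∑ j ∈ M, affectance α N s r β p i j ≤ 3 + 6 * 3 ^ α := by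
    refine core_bound_s13 M _ (fun j => dist (s i) (r j)) (fun j => dist (s i) (s j))
      (fun j => dist (s j) (r j)) π (fun k j => dist (s k) (r j)) F _ hT hF hπ ?_ ?_ ?_ ?_ ?_ ?_
    · intro k hk
      have := (Finset.mem_filter.1 (Finset.mem_filter.1 hk).1).2
      exact (Finset.sum_le_sum_of_subset_of_nonneg (Finset.erase_subset_erase _ hML)
        fun j _ _ => hF k j).trans this
    · intro j; rw [haff]; exact min_le_left _ _
    · intro k j
      have := dist_triangle (s k) (s i) (r j)
      rw [dist_comm (s k) (s i)] at this
      exact this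
    · intro j
      have := dist_triangle (s i) (r j) (s j)
      rw [dist_comm (r j) (s j)] at this
      exact this
    · intro k hk j hj hjk h
      rw [haff]
      exact (min_le_right _ _).trans (ratio_le hα0 (hp i) (hpm k i (hMi k hk))
        (hD i j (hMne j hj).symm) (hD k j hjk.symm) h (hqN j) le_rfl)
    · intro k hk j hj hjk h
      have hne : k ≠ j := fun h => by rw [h] at hjk; exact lt_irrefl _ hjk
      exact hself k j (hqm j k hjk) (p k) le_rfl _ (hD k j hne) h
  have part2 : ∑ j ∈ M, affectance α N s r β p j i ≤ 3 + 6 * 3 ^ α := by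
    refine core_bound_s13 M _ (fun j => dist (s j) (r i)) (fun j => dist (r i) (r j))
      (fun j => dist (s j) (r j)) π (fun k j => dist (s j) (r k)) (fun k j => F j k) _ hT
      (fun k j => hF j k) hπ ?_ ?_ ?_ ?_ ?_ ?_
    · intro k hk
      have := hin k (hML hk)
      have h2 := (Finset.sum_le_sum_of_subset_of_nonneg (Finset.erase_subset_erase k hML)
        fun j _ _ => hF j k).trans this
      linarith
    · intro j; rw [haff]; exact min_le_left _ _
    · intro k j
      have := dist_triangle (s j) (r i) (r k)
      linarith
    · intro j
      have := dist_triangle (r i) (s j) (r j)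
      rw [dist_comm (r i) (s j)] at this
      exact this
    · intro k hk j hj hjk h
      rw [haff]
      exact (min_le_right _ _).trans (ratio_le hα0 (hp j) le_rfl
        (hD j i (hMne j hj)) (hD j k hjk) h (hqN k)
        (sub_le_sub_right (hqm k i (hMi k hk)) N))
    · intro k hk j hj hjk h
      have hne : j ≠ k := fun h => by rw [h] at hjk; exact lt_irrefl _ hjk
      exact hself k k le_rfl (p j) (hpm j k hjk) _ (hD j k hne) h
  linarith
end

section
/- There exists a constant C ≥ 0 depending only on α such that the following holds. Let p : R → ℝ≥0 satisfy (1/β(ℓ))·p(ℓ)/d(ℓ)^α ≤ (1/β(ℓ'))·p(ℓ')/d(ℓ')^α for all ℓ, ℓ' ∈ R with π(ℓ) < π(ℓ'), and p(ℓ)/d(ℓ)^α > β(ℓ)·N for all ℓ ∈ R. Let L ⊆ R be a finite set that is feasible under p. Then for every ℓ ∈ R: Σ_{ℓ'∈L, π(ℓ') < π(ℓ)} a_p(ℓ',ℓ) ≤ C; one may take C = (9^α + 1) + 3^α. -/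
open Finset

universe u v

/-- Incoming affectance bound for feasible sets under a sublinear power assignment:
for every link `ℓ` of the ground set,
`Σ_{ℓ'∈L, π(ℓ')<π(ℓ)} a_p(ℓ',ℓ) ≤ (9^α + 1) + 3^α`. -/
theorem feasible_incoming_affectance_bound
    {X : Type u} {ι : Type v} [MetricSpace X] [Fintype ι] [DecidableEq ι]
    (α N : ℝ) (hα : 1 ≤ α) (hN : 0 < N)
    (s r : ι → X) (β : ι → ℝ) (π : ι → ℕ) (p : ι → ℝ)
    (hβ : ∀ i, 1 ≤ β i)
    (hd : ∀ i, 0 < dist (s i) (r i))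
    (hcross : ∀ i j, i ≠ j → 0 < dist (s i) (r j))
    (hπinj : Function.Injective π)
    (hπ : ∀ i j, π i < π j →
      β j * dist (s j) (r j) ^ α ≤ β i * dist (s i) (r i) ^ α)
    (hp0 : ∀ i, 0 ≤ p i)
    (hsub : ∀ i j, π i < π j →
      (1 / β i) * (p i / dist (s i) (r i) ^ α)
        ≤ (1 / β j) * (p j / dist (s j) (r j) ^ α))
    (hnoise : ∀ i, β i * N < p i / dist (s i) (r i) ^ α)
    (L : Finset ι) (hL : Feasible α N s r β p L) :
    ∀ i : ι, ∑ j ∈ L.filter (fun j => π j < π i), affectance α N s r β p j i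
      ≤ ((9:ℝ) ^ α + 1) + (3:ℝ) ^ α := by
  classical
  intro i
  have hα0 : 0 ≤ α := by linarith
  have hβ0 : ∀ j, 0 < β j := fun j => lt_of_lt_of_le one_pos (hβ j)
  have hdα : ∀ j, 0 < dist (s j) (r j) ^ α := fun j => Real.rpow_pos_of_pos (hd j) α
  have hp : ∀ j, 0 < p j := by
    intro j
    have h1 : 0 < p j / dist (s j) (r j) ^ α :=
      lt_trans (mul_pos (hβ0 j) hN) (hnoise j)
    rcases (hp0 j).lt_or_eq with h | h
    · exact h
    · rw [← h] at h1
      simp at h1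
  -- feasibility, rewritten
  have hfeas : ∀ k ∈ L, β k * ((∑ j ∈ L.erase k, p j / dist (s j) (r k) ^ α) + N)
      ≤ p k / dist (s k) (r k) ^ α := by
    intro k hk
    have h := hL k hk
    unfold sinr at h
    have hs : 0 ≤ ∑ j ∈ L.erase k, p j / dist (s j) (r k) ^ α :=
      Finset.sum_nonneg fun j _ => div_nonneg (hp0 j) (Real.rpow_nonneg dist_nonneg _)
    rwa [le_div_iff₀ (by linarith)] at h
  set M := L.filter (fun j => π j < π i) with hM
  have hML : M ⊆ L := Finset.filter_subset _ _
  have h3 : (3:ℝ) ≤ (3:ℝ) ^ α := by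
    simpa using Real.rpow_le_rpow_of_exponent_le (by norm_num : (1:ℝ) ≤ 3) hα
  have h9 : (9:ℝ) ^ α = (3:ℝ) ^ α * (3:ℝ) ^ α := by
    rw [← Real.mul_rpow (by norm_num) (by norm_num)]
    norm_num
  rcases M.eq_empty_or_nonempty with hMe | hMne
  · rw [hMe, Finset.sum_empty]
    nlinarith
  obtain ⟨k, hkM, hkmin⟩ := Finset.exists_min_image M (fun j => dist (r j) (r i)) hMne
  have hkL : k ∈ L := hML hkM
  have hki : π k < π i := (Finset.mem_filter.mp hkM).2
  set Q := p i / dist (s i) (r i) ^ α - β i * N with hQ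
  have hQ0 : 0 < Q := by have := hnoise i; linarith
  have hle1 : ∀ j, affectance α N s r β p j i ≤ 1 := fun j => min_le_left _ _
  let F : ι → Prop := fun j => 2 * dist (s j) (r i) < dist (r k) (r i)
  rw [← Finset.sum_filter_add_sum_filter_not M F]
  -- near links
  have hB : ∑ j ∈ M.filter F, affectance α N s r β p j i ≤ (3:ℝ) ^ α + 1 := by
    have hc : ∑ j ∈ M.filter F, affectance α N s r β p j i ≤ ((M.filter F).card : ℝ) := by
      calc _ ≤ ∑ j ∈ M.filter F, (1:ℝ) := Finset.sum_le_sum fun j _ => hle1 j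
        _ = _ := by simp
    refine hc.trans ?_
    rcases (M.filter F).eq_empty_or_nonempty with hBe | hBne
    · rw [hBe]
      simp
      linarith
    obtain ⟨m, hmB, hmmin⟩ := Finset.exists_min_image (M.filter F) p hBne
    have hmM : m ∈ M := (Finset.mem_filter.mp hmB).1
    have hmF : 2 * dist (s m) (r i) < dist (r k) (r i) := (Finset.mem_filter.mp hmB).2
    have hmk : dist (r k) (r i) ≤ dist (r m) (r i) := hkmin m hmM
    have htri : dist (r m) (r i) ≤ dist (s m) (r m) + dist (s m) (r i) := by
      have := dist_triangle (r m) (s m) (r i)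
      rwa [dist_comm (r m) (s m)] at this
    have hterm : ∀ j ∈ (M.filter F).erase m,
        p m / ((3:ℝ) ^ α * dist (s m) (r m) ^ α) ≤ p j / dist (s j) (r m) ^ α := by
      intro j hj
      obtain ⟨hjm, hjB⟩ := Finset.mem_erase.mp hj
      have hjF : 2 * dist (s j) (r i) < dist (r k) (r i) := (Finset.mem_filter.mp hjB).2
      have hD : dist (s j) (r m) ≤ 3 * dist (s m) (r m) := by
        have h1 := dist_triangle (s j) (r i) (r m)
        have h2 := dist_triangle (r i) (s m) (r m)
        rw [dist_comm (r i) (s m)] at h2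
        linarith
      have hDp : 0 < dist (s j) (r m) := hcross j m hjm
      have hpw : dist (s j) (r m) ^ α ≤ (3:ℝ) ^ α * dist (s m) (r m) ^ α := by
        rw [← Real.mul_rpow (by norm_num) dist_nonneg]
        exact Real.rpow_le_rpow dist_nonneg hD hα0
      exact div_le_div₀ (hp0 j) (hmmin j hjB) (Real.rpow_pos_of_pos hDp α) hpw
    have hsub1 : (M.filter F).erase m ⊆ L.erase m :=
      Finset.erase_subset_erase m ((Finset.filter_subset _ _).trans hML)
    have hs1 : ∑ j ∈ (M.filter F).erase m, p m / ((3:ℝ) ^ α * dist (s m) (r m) ^ α)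
        ≤ ∑ j ∈ L.erase m, p j / dist (s j) (r m) ^ α :=
      (Finset.sum_le_sum hterm).trans
        (Finset.sum_le_sum_of_subset_of_nonneg hsub1 fun j _ _ =>
          div_nonneg (hp0 j) (Real.rpow_nonneg dist_nonneg _))
    have hs0 : 0 ≤ ∑ j ∈ L.erase m, p j / dist (s j) (r m) ^ α :=
      Finset.sum_nonneg fun j _ => div_nonneg (hp0 j) (Real.rpow_nonneg dist_nonneg _)
    have hf := hfeas m (hML hmM)
    have hs2 : ∑ j ∈ L.erase m, p j / dist (s j) (r m) ^ α ≤ p m / dist (s m) (r m) ^ α := by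
      nlinarith [hβ m]
    have hs3 := hs1.trans hs2
    rw [Finset.sum_const, nsmul_eq_mul, Finset.card_erase_of_mem hmB,
      Nat.cast_sub (Finset.card_pos.mpr hBne)] at hs3
    have hP : 0 < p m / dist (s m) (r m) ^ α := div_pos (hp m) (hdα m)
    have h30 : (0:ℝ) < (3:ℝ) ^ α := by linarith
    have he : p m / ((3:ℝ) ^ α * dist (s m) (r m) ^ α)
        = (p m / dist (s m) (r m) ^ α) / (3:ℝ) ^ α := by
      rw [div_div, mul_comm]
    rw [he, ← mul_div_assoc, div_le_iff₀ h30, mul_comm] at hs3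
    have hs4 := le_of_mul_le_mul_left hs3 hP
    push_cast at hs4
    linarith
  -- far links
  have hA : ∑ j ∈ M.filter (fun j => ¬ F j), affectance α N s r β p j i ≤ (3:ℝ) ^ α + 1 := by
    have hterm : ∀ j ∈ (M.filter (fun j => ¬ F j)).erase k, affectance α N s r β p j i
        ≤ (β i * (3:ℝ) ^ α / Q) * (p j / dist (s j) (r k) ^ α) := by
      intro j hj
      obtain ⟨hjk, hjA⟩ := Finset.mem_erase.mp hj
      obtain ⟨hjM, hjF⟩ := Finset.mem_filter.mp hjA
      have hjF' : dist (r k) (r i) ≤ 2 * dist (s j) (r i) := not_lt.mp hjF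
      have hji : j ≠ i := by
        rintro rfl
        exact lt_irrefl _ (Finset.mem_filter.mp hjM).2
      have hD : dist (s j) (r k) ≤ 3 * dist (s j) (r i) := by
        have h1 := dist_triangle (s j) (r i) (r k)
        rw [dist_comm (r i) (r k)] at h1
        linarith
      have hpw : dist (s j) (r k) ^ α ≤ (3:ℝ) ^ α * dist (s j) (r i) ^ α := by
        rw [← Real.mul_rpow (by norm_num) dist_nonneg]
        exact Real.rpow_le_rpow dist_nonneg hD hα0
      have hE : 0 < dist (s j) (r k) ^ α := Real.rpow_pos_of_pos (hcross j k hjk) α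
      have hE' : 0 < dist (s j) (r i) ^ α := Real.rpow_pos_of_pos (hcross j i hji) α
      have hx : p j / dist (s j) (r i) ^ α ≤ (3:ℝ) ^ α * (p j / dist (s j) (r k) ^ α) := by
        rw [← mul_div_assoc, div_le_div_iff₀ hE' hE]
        nlinarith [hp0 j]
      have h2 : affectance α N s r β p j i ≤ β i * (p j / dist (s j) (r i) ^ α) / Q :=
        min_le_right _ _
      refine h2.trans ?_
      calc β i * (p j / dist (s j) (r i) ^ α) / Q
          ≤ β i * ((3:ℝ) ^ α * (p j / dist (s j) (r k) ^ α)) / Q := by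
            have := (hβ0 i).le
            gcongr
        _ = _ := by ring
    have hsub1 : (M.filter (fun j => ¬ F j)).erase k ⊆ L.erase k :=
      Finset.erase_subset_erase k ((Finset.filter_subset _ _).trans hML)
    have hcoef : 0 ≤ β i * (3:ℝ) ^ α / Q :=
      div_nonneg (mul_nonneg (hβ0 i).le (by linarith)) hQ0.le
    have hsL : β i * ∑ j ∈ L.erase k, p j / dist (s j) (r k) ^ α ≤ Q := by
      have hf := hfeas k hkL
      have hq := hsub k i hki
      have h1 : (∑ j ∈ L.erase k, p j / dist (s j) (r k) ^ α) + N
          ≤ (1 / β k) * (p k / dist (s k) (r k) ^ α) := by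
        rw [one_div_mul_eq_div, le_div_iff₀ (hβ0 k)]
        linarith
      have h2 := h1.trans hq
      rw [one_div_mul_eq_div, le_div_iff₀ (hβ0 i)] at h2
      rw [hQ]
      linarith
    have hs1 : ∑ j ∈ (M.filter (fun j => ¬ F j)).erase k, affectance α N s r β p j i
        ≤ (3:ℝ) ^ α := by
      refine (Finset.sum_le_sum hterm).trans ?_
      rw [← Finset.mul_sum]
      have h1 : ∑ j ∈ (M.filter (fun j => ¬ F j)).erase k, p j / dist (s j) (r k) ^ α
          ≤ ∑ j ∈ L.erase k, p j / dist (s j) (r k) ^ α :=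
        Finset.sum_le_sum_of_subset_of_nonneg hsub1 fun j _ _ =>
          div_nonneg (hp0 j) (Real.rpow_nonneg dist_nonneg _)
      refine (mul_le_mul_of_nonneg_left h1 hcoef).trans ?_
      rw [div_mul_eq_mul_div, div_le_iff₀ hQ0]
      nlinarith
    by_cases hkA : k ∈ M.filter (fun j => ¬ F j)
    · rw [← Finset.sum_erase_add _ _ hkA]
      have := hle1 k
      linarith
    · rw [Finset.erase_eq_of_notMem hkA] at hs1
      linarith
  nlinarith
end

section
/- There exists a constant C ≥ 0 depending only on α such that the following holds. Let p : R → ℝ≥0 satisfy p(ℓ) ≥ p(ℓ') for all ℓ, ℓ' ∈ R with π(ℓ) < π(ℓ'), and p(ℓ)/d(ℓ)^α > β(ℓ)·N for all ℓ ∈ R. Let L ⊆ R be a finite set that is feasible under p. Then there is a subset L' ⊆ L with |L'| ≥ |L|/2 such that for every ℓ ∈ R: Σ_{ℓ'∈L', π(ℓ') < π(ℓ)} a_p(ℓ,ℓ') ≤ C. -/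
open Finset

universe u v

lemma markov_aux {ι : Type*} [DecidableEq ι] (a : ι → ι → ℝ) (ha : ∀ i j, 0 ≤ a i j)
    (L : Finset ι) (h : ∀ i ∈ L, ∑ j ∈ L.erase i, a j i ≤ 1) :
    ∃ L' ⊆ L, (L.card : ℝ) / 2 ≤ (L'.card : ℝ) ∧ ∀ k ∈ L', ∑ j ∈ L.erase k, a k j ≤ 2 := by
  classical
  refine ⟨L.filter (fun k => ∑ j ∈ L.erase k, a k j ≤ 2), Finset.filter_subset _ _, ?_, ?_⟩
  · have hc := Finset.card_filter_add_card_filter_not (s := L)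
      (fun k => ∑ j ∈ L.erase k, a k j ≤ 2)
    set B := L.filter (fun k => ¬ ∑ j ∈ L.erase k, a k j ≤ 2) with hB
    have h1 : (B.card : ℝ) * 2 ≤ ∑ k ∈ B, ∑ j ∈ L.erase k, a k j := by
      rw [← nsmul_eq_mul]
      apply Finset.card_nsmul_le_sum
      intro k hk
      rw [hB, Finset.mem_filter] at hk
      exact (not_le.mp hk.2).le
    have h2 : ∑ k ∈ B, ∑ j ∈ L.erase k, a k j ≤ ∑ k ∈ L, ∑ j ∈ L.erase k, a k j :=
      Finset.sum_le_sum_of_subset_of_nonneg (Finset.filter_subset _ _)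
        (fun k _ _ => Finset.sum_nonneg (fun j _ => ha k j))
    have h3 : ∑ k ∈ L, ∑ j ∈ L.erase k, a k j = ∑ j ∈ L, ∑ k ∈ L.erase j, a k j := by
      apply Finset.sum_comm'
      intro x y
      simp only [Finset.mem_erase]
      tauto
    have h4 : ∑ j ∈ L, ∑ k ∈ L.erase j, a k j ≤ (L.card : ℝ) := by
      have := Finset.sum_le_card_nsmul L (fun j => ∑ k ∈ L.erase j, a k j) 1 h
      simpa using this
    have hc' : ((L.filter (fun k => ∑ j ∈ L.erase k, a k j ≤ 2)).card : ℝ) + B.card = L.card := by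
      exact_mod_cast hc
    linarith
  · intro k hk
    exact (Finset.mem_filter.mp hk).2

lemma card_aux {ι : Type*} [DecidableEq ι] (Q : ι → ℝ) (U : Finset ι) (c : ℝ) (hc : 0 ≤ c)
    (hQ : ∀ j ∈ U, 0 < Q j) (h : ∀ j ∈ U, ∑ i ∈ U.erase j, Q i ≤ c * Q j) :
    (U.card : ℝ) ≤ c + 1 := by
  rcases U.eq_empty_or_nonempty with rfl | hne
  · simp; linarith
  have hS : 0 < ∑ i ∈ U, Q i := Finset.sum_pos hQ hne
  have h1 : (U.card : ℝ) * ∑ i ∈ U, Q i ≤ ∑ j ∈ U, (c + 1) * Q j := by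
    rw [← nsmul_eq_mul]
    apply Finset.card_nsmul_le_sum
    intro j hj
    have := h j hj
    have e := Finset.add_sum_erase U Q hj
    linarith
  rw [← Finset.mul_sum] at h1
  exact le_of_mul_le_mul_right h1 hS

lemma feas_aux {X : Type u} {ι : Type v} [MetricSpace X] [DecidableEq ι]
    {α N : ℝ} {s r : ι → X} {β p : ι → ℝ} {L : Finset ι} (hN : 0 < N)
    (hp : ∀ i, 0 ≤ p i) (hf : Feasible α N s r β p L) {i : ι} (hi : i ∈ L) :
    β i * ∑ j ∈ L.erase i, p j / dist (s j) (r i) ^ α ≤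
      p i / dist (s i) (r i) ^ α - β i * N := by
  have h := hf i hi
  unfold sinr at h
  have hI : 0 ≤ ∑ j ∈ L.erase i, p j / dist (s j) (r i) ^ α :=
    Finset.sum_nonneg (fun j _ => div_nonneg (hp j) (Real.rpow_nonneg dist_nonneg _))
  rw [le_div_iff₀ (by linarith)] at h
  linarith

theorem feasible_outgoing_affectance_bound (α : ℝ) (hα : 1 ≤ α) :
    ∃ C : ℝ, 0 ≤ C ∧
      ∀ (X : Type u) (ι : Type v) [MetricSpace X] [Fintype ι] [DecidableEq ι]
        (N : ℝ) (s r : ι → X) (β : ι → ℝ) (π : ι → ℕ) (p : ι → ℝ),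
        0 < N →
        (∀ i, 1 ≤ β i) →
        (∀ i, 0 < dist (s i) (r i)) →
        (∀ i j, i ≠ j → 0 < dist (s i) (r j)) →
        Function.Injective π →
        (∀ i j, π i < π j →
          β j * dist (s j) (r j) ^ α ≤ β i * dist (s i) (r i) ^ α) →
        (∀ i, 0 ≤ p i) →
        (∀ i j, π i < π j → p j ≤ p i) →
        (∀ i, β i * N < p i / dist (s i) (r i) ^ α) →
        ∀ L : Finset ι, Feasible α N s r β p L →
          ∃ L' ⊆ L, (L.card : ℝ) / 2 ≤ (L'.card : ℝ) ∧
            ∀ i : ι, ∑ j ∈ L'.filter (fun j => π j < π i),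
                affectance α N s r β p i j ≤ C := by
  have h3 : (0:ℝ) ≤ 3 ^ α := Real.rpow_nonneg (by norm_num) _
  refine ⟨3 ^ α * 2 + 1 + (3 ^ α + 1), by linarith, ?_⟩
  intro X ι _ _ _ N s r β π p hN hβ hd hd' hπ _ hp hmono hpos L hL
  have hα0 : 0 ≤ α := by linarith
  have hw : ∀ j, 0 < p j / dist (s j) (r j) ^ α - β j * N := fun j => by
    linarith [hpos j]
  have hβ0 : ∀ j, 0 ≤ β j := fun j => by linarith [hβ j]
  have hx : ∀ i j, 0 ≤ p i / dist (s i) (r j) ^ α := fun i j =>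
    div_nonneg (hp i) (Real.rpow_nonneg dist_nonneg _)
  have hp0 : ∀ j, 0 < p j := by
    intro j
    have h1 : 0 < p j / dist (s j) (r j) ^ α :=
      lt_of_le_of_lt (mul_nonneg (hβ0 j) hN.le) (hpos j)
    by_contra hcon
    have h0 : p j = 0 := le_antisymm (not_lt.mp hcon) (hp j)
    rw [h0, zero_div] at h1
    exact lt_irrefl _ h1
  have ha : ∀ i j, 0 ≤ affectance α N s r β p i j := fun i j =>
    le_min zero_le_one (div_nonneg (mul_nonneg (hβ0 j) (hx i j)) (hw j).le)
  have ha1 : ∀ i j, affectance α N s r β p i j ≤ 1 := fun i j => min_le_left _ _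
  have hin : ∀ i ∈ L, ∑ j ∈ L.erase i, affectance α N s r β p j i ≤ 1 := by
    intro i hi
    have h1 : ∑ j ∈ L.erase i, affectance α N s r β p j i ≤
        ∑ j ∈ L.erase i, β i * (p j / dist (s j) (r i) ^ α) /
          (p i / dist (s i) (r i) ^ α - β i * N) :=
      Finset.sum_le_sum (fun j _ => min_le_right _ _)
    rw [← Finset.sum_div, ← Finset.mul_sum] at h1
    exact h1.trans ((div_le_one (hw i)).mpr (feas_aux hN hp hL hi))
  obtain ⟨L', hL', hcard, hout⟩ := markov_aux (affectance α N s r β p) ha L hin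
  refine ⟨L', hL', hcard, ?_⟩
  intro ℓ
  set A := L'.filter (fun j => π j < π ℓ) with hA
  rcases A.eq_empty_or_nonempty with hAe | hAne
  · rw [hAe, Finset.sum_empty]; linarith
  obtain ⟨k, hkA, hkmin⟩ := Finset.exists_min_image A (fun j => dist (s ℓ) (s j)) hAne
  have memA : ∀ j ∈ A, j ∈ L' ∧ j ∈ L ∧ π j < π ℓ := fun j hj => by
    have := Finset.mem_filter.mp hj
    exact ⟨this.1, hL' this.1, this.2⟩
  have hne : ∀ j ∈ A, ℓ ≠ j := fun j hj h => by
    have := (memA j hj).2.2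
    rw [h] at this
    exact lt_irrefl _ this
  set m := dist (s ℓ) (s k) with hm
  have hm0 : 0 ≤ m := dist_nonneg
  rw [← Finset.sum_filter_add_sum_filter_not A (fun j => m / 2 ≤ dist (s ℓ) (r j))]
  have hV : ∑ j ∈ A.filter (fun j => m / 2 ≤ dist (s ℓ) (r j)), affectance α N s r β p ℓ j
      ≤ 3 ^ α * 2 + 1 := by
    set V := A.filter (fun j => m / 2 ≤ dist (s ℓ) (r j)) with hVdef
    have hVk : ∑ j ∈ V, affectance α N s r β p ℓ j ≤
        ∑ j ∈ V.erase k, affectance α N s r β p ℓ j + 1 := by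
      by_cases hk : k ∈ V
      · rw [← Finset.add_sum_erase V _ hk]
        linarith [ha1 ℓ k]
      · rw [Finset.erase_eq_of_notMem hk]; linarith
    have hstep : ∀ j ∈ V.erase k, affectance α N s r β p ℓ j ≤
        3 ^ α * affectance α N s r β p k j := by
      intro j hj
      obtain ⟨hjk, hjV⟩ := Finset.mem_erase.mp hj
      obtain ⟨hjA, hjm⟩ := Finset.mem_filter.mp hjV
      have hD : 0 < dist (s ℓ) (r j) := hd' ℓ j (hne j hjA)
      have hK : 0 < dist (s k) (r j) := hd' k j (Ne.symm hjk)
      have hle : dist (s k) (r j) ≤ 3 * dist (s ℓ) (r j) := by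
        have := dist_triangle (s k) (s ℓ) (r j)
        rw [dist_comm (s k) (s ℓ)] at this
        linarith
      have hpow : dist (s k) (r j) ^ α ≤ 3 ^ α * dist (s ℓ) (r j) ^ α := by
        rw [← Real.mul_rpow (by norm_num) hD.le]
        exact Real.rpow_le_rpow hK.le hle hα0
      have hDp : 0 < dist (s ℓ) (r j) ^ α := Real.rpow_pos_of_pos hD _
      have hKp : 0 < dist (s k) (r j) ^ α := Real.rpow_pos_of_pos hK _
      have hpk : p ℓ ≤ p k := hmono k ℓ (memA k hkA).2.2
      have hrat : p ℓ / dist (s ℓ) (r j) ^ α ≤ 3 ^ α * (p k / dist (s k) (r j) ^ α) := by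
        rw [← mul_div_assoc, div_le_div_iff₀ hDp hKp]
        calc p ℓ * dist (s k) (r j) ^ α ≤ p k * (3 ^ α * dist (s ℓ) (r j) ^ α) :=
              mul_le_mul hpk hpow hKp.le (hp k)
          _ = _ := by ring
      have h31 : (1:ℝ) ≤ 3 ^ α := Real.one_le_rpow (by norm_num) hα0
      unfold affectance
      rw [mul_min_of_nonneg _ _ h3]
      apply min_le_min
      · linarith
      · rw [← mul_div_assoc ((3:ℝ) ^ α)]
        apply div_le_div_of_nonneg_right _ (hw j).le
        calc β j * (p ℓ / dist (s ℓ) (r j) ^ α)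
            ≤ β j * (3 ^ α * (p k / dist (s k) (r j) ^ α)) :=
              mul_le_mul_of_nonneg_left hrat (hβ0 j)
          _ = _ := by ring
    have h1 := Finset.sum_le_sum hstep
    rw [← Finset.mul_sum] at h1
    have hsub : V.erase k ⊆ L.erase k := Finset.erase_subset_erase _ (fun j hj =>
      (memA j (Finset.mem_filter.mp hj).1).2.1)
    have h2 : ∑ j ∈ V.erase k, affectance α N s r β p k j ≤ 2 :=
      (Finset.sum_le_sum_of_subset_of_nonneg hsub (fun j _ _ => ha k j)).trans
        (hout k (memA k hkA).1)
    have h4 := mul_le_mul_of_nonneg_left h2 h3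
    linarith
  have hU : ∑ j ∈ A.filter (fun j => ¬ m / 2 ≤ dist (s ℓ) (r j)), affectance α N s r β p ℓ j
      ≤ 3 ^ α + 1 := by
    set U := A.filter (fun j => ¬ m / 2 ≤ dist (s ℓ) (r j)) with hUdef
    have h1 : ∑ j ∈ U, affectance α N s r β p ℓ j ≤ (U.card : ℝ) := by
      have := Finset.sum_le_card_nsmul U (fun j => affectance α N s r β p ℓ j) 1
        (fun j _ => ha1 ℓ j)
      simpa using this
    refine h1.trans ?_
    have hUm : ∀ j ∈ U, j ∈ A ∧ dist (s ℓ) (r j) < m / 2 ∧ m ≤ dist (s ℓ) (s j) := fun j hj => by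
      have := Finset.mem_filter.mp hj
      exact ⟨this.1, not_le.mp this.2, hkmin j this.1⟩
    have he : ∀ j ∈ U, 0 < dist (s ℓ) (s j) := fun j hj => by
      obtain ⟨-, h2, h4⟩ := hUm j hj
      have : 0 ≤ dist (s ℓ) (r j) := dist_nonneg
      linarith
    apply card_aux (fun j => p j / dist (s ℓ) (s j) ^ α) U _ h3
    · intro j hj
      exact div_pos (hp0 j) (Real.rpow_pos_of_pos (he j hj) _)
    · intro j hj
      obtain ⟨hjA, hj2, hj3⟩ := hUm j hj
      have hjL := (memA j hjA).2.1
      have hfe := feas_aux hN hp hL hjL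
      have hsub : U.erase j ⊆ L.erase j := Finset.erase_subset_erase _ (fun i hi =>
        (memA i (hUm i hi).1).2.1)
      have hs1 : ∑ i ∈ U.erase j, p i / dist (s i) (r j) ^ α ≤
          ∑ i ∈ L.erase j, p i / dist (s i) (r j) ^ α :=
        Finset.sum_le_sum_of_subset_of_nonneg hsub (fun i _ _ => hx i j)
      have hs0 : 0 ≤ ∑ i ∈ L.erase j, p i / dist (s i) (r j) ^ α :=
        Finset.sum_nonneg (fun i _ => hx i j)
      have hs2 : ∑ i ∈ L.erase j, p i / dist (s i) (r j) ^ α ≤ p j / dist (s j) (r j) ^ α := by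
        have := mul_nonneg (hβ0 j) hN.le
        have := mul_le_mul_of_nonneg_right (hβ j) hs0
        linarith
      have hterm : ∀ i ∈ U.erase j, p i / dist (s ℓ) (s i) ^ α ≤
          (3 / 2) ^ α * (p i / dist (s i) (r j) ^ α) := by
        intro i hi
        obtain ⟨hij, hiU⟩ := Finset.mem_erase.mp hi
        obtain ⟨hiA, hi2, hi3⟩ := hUm i hiU
        have hK : 0 < dist (s i) (r j) := hd' i j hij
        have hle : dist (s i) (r j) ≤ 3 / 2 * dist (s ℓ) (s i) := by
          have := dist_triangle (s i) (s ℓ) (r j)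
          rw [dist_comm (s i) (s ℓ)] at this
          linarith
        have hpow : dist (s i) (r j) ^ α ≤ (3 / 2) ^ α * dist (s ℓ) (s i) ^ α := by
          rw [← Real.mul_rpow (by norm_num) (he i hiU).le]
          exact Real.rpow_le_rpow hK.le hle hα0
        rw [← mul_div_assoc, div_le_div_iff₀ (Real.rpow_pos_of_pos (he i hiU) _)
          (Real.rpow_pos_of_pos hK _)]
        calc p i * dist (s i) (r j) ^ α ≤ p i * ((3 / 2) ^ α * dist (s ℓ) (s i) ^ α) :=
              mul_le_mul_of_nonneg_left hpow (hp i)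
          _ = _ := by ring
      have hq : p j / dist (s j) (r j) ^ α ≤ 2 ^ α * (p j / dist (s ℓ) (s j) ^ α) := by
        have hle : dist (s ℓ) (s j) ≤ 2 * dist (s j) (r j) := by
          have := dist_triangle (s ℓ) (r j) (s j)
          rw [dist_comm (r j) (s j)] at this
          linarith
        have hpow : dist (s ℓ) (s j) ^ α ≤ 2 ^ α * dist (s j) (r j) ^ α := by
          rw [← Real.mul_rpow (by norm_num) (hd j).le]
          exact Real.rpow_le_rpow (he j hj).le hle hα0
        rw [← mul_div_assoc, div_le_div_iff₀ (Real.rpow_pos_of_pos (hd j) _)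
          (Real.rpow_pos_of_pos (he j hj) _)]
        calc p j * dist (s ℓ) (s j) ^ α ≤ p j * (2 ^ α * dist (s j) (r j) ^ α) :=
              mul_le_mul_of_nonneg_left hpow (hp j)
          _ = _ := by ring
      have h32 : (0:ℝ) ≤ (3 / 2) ^ α := Real.rpow_nonneg (by norm_num) _
      calc ∑ i ∈ U.erase j, p i / dist (s ℓ) (s i) ^ α
          ≤ ∑ i ∈ U.erase j, (3 / 2) ^ α * (p i / dist (s i) (r j) ^ α) :=
            Finset.sum_le_sum hterm
        _ = (3 / 2) ^ α * ∑ i ∈ U.erase j, p i / dist (s i) (r j) ^ α := by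
            rw [Finset.mul_sum]
        _ ≤ (3 / 2) ^ α * (2 ^ α * (p j / dist (s ℓ) (s j) ^ α)) :=
            mul_le_mul_of_nonneg_left (hs1.trans (hs2.trans hq)) h32
        _ = 3 ^ α * (p j / dist (s ℓ) (s j) ^ α) := by
            rw [← mul_assoc, ← Real.mul_rpow (by norm_num) (by norm_num)]
            norm_num
  linarith
end
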